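/- arXiv:2310.13478 — 6 statements merged into one kernel-verified Lean document; each statement's English description precedes it below -/
import Mathlib

section
/- Let X be a real random variable with distribution μ, and define its halfspace (Tukey) depth by HD(y;X) := min(P(X ≤ y), P(X ≥ y)) for y ∈ ℝ. Then x ∈ Med(X) if and only if HD(x;X) = sup_{y ∈ ℝ} HD(y;X), i.e., the set of medians of X is exactly the set of maximizers of the halfspace depth. -/
open MeasureTheory

open Filter Set Topology in
/-- Every probability measure on the real line has a median. -/
theorem exists_median_of_isProbabilityMeasure (μ : Measure ℝ) [IsProbabilityMeasure μ] :
    ∃ m : ℝ, 1/2 ≤ μ (Iic m) ∧ 1/2 ≤ μ (Ici m) := by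
  set F := ProbabilityTheory.cdf μ
  set A : Set ℝ := {t | 1/2 ≤ F t}
  have hne : A.Nonempty :=
    ((ProbabilityTheory.tendsto_cdf_atTop μ).eventually_const_le (by norm_num)).exists
  have hbdd : BddBelow A := by
    obtain ⟨b, hb⟩ := ((ProbabilityTheory.tendsto_cdf_atBot μ).eventually_lt_const
      (show (0 : ℝ) < 1/2 by norm_num)).exists
    refine ⟨b, fun t ht => ?_⟩
    by_contra! h
    exact absurd (F.mono h.le) (not_le.2 (hb.trans_le ht))
  set m := sInf A
  have hright : 1/2 ≤ F m := by
    have hcont : Tendsto F (𝓝[>] m) (𝓝 (F m)) :=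
      (F.right_continuous m).mono_left (nhdsWithin_mono _ Ioi_subset_Ici_self)
    refine ge_of_tendsto hcont ?_
    filter_upwards [self_mem_nhdsWithin] with t ht
    obtain ⟨s, hs, hst⟩ := exists_lt_of_csInf_lt hne ht
    exact le_trans hs (F.mono hst.le)
  have hleft : Function.leftLim F m ≤ 1/2 := by
    refine le_of_tendsto (F.mono.tendsto_leftLim m) ?_
    filter_upwards [self_mem_nhdsWithin] with t ht
    exact (not_le.1 fun h => notMem_of_lt_csInf ht hbdd h).le
  have half : ENNReal.ofReal (1/2) = 1/2 := by
    rw [ENNReal.ofReal_div_of_pos two_pos]; simp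
  refine ⟨m, ?_, ?_⟩
  · rw [← ProbabilityTheory.ofReal_cdf, ← half]
    exact ENNReal.ofReal_le_ofReal hright
  · rw [← ProbabilityTheory.measure_cdf μ,
      StieltjesFunction.measure_Ici _ (ProbabilityTheory.tendsto_cdf_atTop μ), ← half]
    exact ENNReal.ofReal_le_ofReal (by linarith)

/-- If a measurable set has probability at least one half, any set disjoint from it has
probability at most one half. -/
theorem measure_le_half_of_disjoint {Ω : Type*} [MeasurableSpace Ω] (P : Measure Ω)
    [IsProbabilityMeasure P] {s t : Set Ω} (hs : MeasurableSet s) (hst : Disjoint s t)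
    (h : 1/2 ≤ P s) : P t ≤ 1/2 :=
  calc P t ≤ P sᶜ := measure_mono hst.subset_compl_left
    _ = 1 - P s := prob_compl_eq_one_sub hs
    _ ≤ 1 - 1/2 := tsub_le_tsub_left h 1
    _ = 1/2 := by rw [one_div, ENNReal.one_sub_inv_two]

/-- The set of medians of a real random variable `X` is exactly the set of maximizers of
the halfspace (Tukey) depth `HD(y;X) := min(P(X ≤ y), P(X ≥ y))`. -/
theorem median_iff_maximizes_halfspace_depth
    {Ω : Type*} [MeasurableSpace Ω] (P : Measure Ω) [IsProbabilityMeasure P]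
    (X : Ω → ℝ) (hX : Measurable X) (x : ℝ) :
    (1/2 ≤ P {ω | X ω ≤ x} ∧ 1/2 ≤ P {ω | x ≤ X ω}) ↔
      min (P {ω | X ω ≤ x}) (P {ω | x ≤ X ω}) =
        ⨆ y : ℝ, min (P {ω | X ω ≤ y}) (P {ω | y ≤ X ω}) := by
  constructor
  · rintro ⟨h₁, h₂⟩
    refine le_antisymm
      (le_iSup (fun y : ℝ => min (P {ω | X ω ≤ y}) (P {ω | y ≤ X ω})) x) (iSup_le fun y => ?_)
    rcases lt_trichotomy x y with hxy | rfl | hxy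
    · refine (min_le_right _ _).trans (le_trans ?_ (le_min h₁ h₂))
      refine measure_le_half_of_disjoint P (measurableSet_le hX measurable_const) ?_ h₁
      exact Set.disjoint_left.2 fun ω (h : X ω ≤ x) (h' : y ≤ X ω) => by linarith
    · exact le_rfl
    · refine (min_le_left _ _).trans (le_trans ?_ (le_min h₁ h₂))
      refine measure_le_half_of_disjoint P (measurableSet_le measurable_const hX) ?_ h₂
      exact Set.disjoint_left.2 fun ω (h : x ≤ X ω) (h' : X ω ≤ y) => by linarith
  · intro h
    have : IsProbabilityMeasure (P.map X) := Measure.isProbabilityMeasure_map hX.aemeasurable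
    obtain ⟨m, h₁, h₂⟩ := exists_median_of_isProbabilityMeasure (P.map X)
    rw [Measure.map_apply hX measurableSet_Iic] at h₁
    rw [Measure.map_apply hX measurableSet_Ici] at h₂
    rw [← le_min_iff, h]
    exact le_iSup_of_le m (le_min h₁ h₂)
end

section
/- Let 𝒳 be a fuzzy random number with 𝒳 ∈ L¹. Then Med_1(𝒳) = Med_s(𝒳): a fuzzy number A minimizes U ↦ E[ρ_1(U,𝒳)] over F_c(ℝ) if and only if s_A(u,α) ∈ Med(s_𝒳(u,α)) for every u ∈ {−1,1} and every α ∈ [0,1]. -/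
open MeasureTheory Set ENNReal

noncomputable section

/-- The α-levels of a membership function `A : ℝ → [0,1]`. -/
def fuzzyLevel (A : ℝ → ℝ) (α : ℝ) : Set ℝ :=
  if α = 0 then closure {x | 0 < A x} else {x | α ≤ A x}

/-- A fuzzy number: a function `ℝ → [0,1]` all of whose α-levels (α ∈ [0,1])
are nonempty compact convex subsets of ℝ. -/
structure FuzzyNumber where
  mem : ℝ → ℝ
  mem_range : ∀ x, mem x ∈ Set.Icc (0:ℝ) 1
  level_nonempty : ∀ α ∈ Set.Icc (0:ℝ) 1, (fuzzyLevel mem α).Nonempty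
  level_compact : ∀ α ∈ Set.Icc (0:ℝ) 1, IsCompact (fuzzyLevel mem α)
  level_convex : ∀ α ∈ Set.Icc (0:ℝ) 1, Convex ℝ (fuzzyLevel mem α)

/-- Support function of a fuzzy number. -/
def suppFn (A : FuzzyNumber) (u α : ℝ) : ℝ :=
  sSup ((fun v => u * v) '' fuzzyLevel A.mem α)

/-- Set of medians of a real random variable. -/
def MedSet {Ω : Type*} [MeasurableSpace Ω] (P : Measure Ω) (Y : Ω → ℝ) : Set ℝ :=
  {m : ℝ | 1/2 ≤ P {ω | Y ω ≤ m} ∧ 1/2 ≤ P {ω | m ≤ Y ω}}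

/-- A fuzzy number is a support median of a fuzzy random number. -/
def IsSupportMedian {Ω : Type*} [MeasurableSpace Ω] (P : Measure Ω)
    (𝒳 : Ω → FuzzyNumber) (A : FuzzyNumber) : Prop :=
  ∀ u ∈ ({-1, 1} : Set ℝ), ∀ α ∈ Set.Icc (0:ℝ) 1,
    suppFn A u α ∈ MedSet P (fun ω => suppFn (𝒳 ω) u α)

/-- Measurability of each real random variable `s_𝒳(u,α)`. -/
def SuppMeasurable {Ω : Type*} [MeasurableSpace Ω] (𝒳 : Ω → FuzzyNumber) : Prop :=
  ∀ u ∈ ({-1, 1} : Set ℝ), ∀ α ∈ Set.Icc (0:ℝ) 1,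
    Measurable fun ω => suppFn (𝒳 ω) u α

/-- Joint measurability of `(u,α,ω) ↦ s_{𝒳(ω)}(u,α)` on {−1,1}×[0,1]×Ω. -/
def JointlyMeasurable {Ω : Type*} [MeasurableSpace Ω] (𝒳 : Ω → FuzzyNumber) : Prop :=
  Measurable fun q : ({-1, 1} : Set ℝ) × (Set.Icc (0:ℝ) 1) × Ω =>
    suppFn (𝒳 q.2.2) (q.1 : ℝ) (q.2.1 : ℝ)

/-- The ρ₁ metric between fuzzy numbers. -/
def rho1 (A B : FuzzyNumber) : ℝ :=
  (1/2) * ∫ α in (0:ℝ)..1,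
    (|suppFn A 1 α - suppFn B 1 α| + |suppFn A (-1) α - suppFn B (-1) α|)

/-- `𝒳 ∈ L¹`: the random variable `sup_{x ∈ 𝒳₀} |x|` is integrable. -/
def FuzzyL1 {Ω : Type*} [MeasurableSpace Ω] (P : Measure Ω) (𝒳 : Ω → FuzzyNumber) : Prop :=
  Integrable (fun ω => sSup ((fun x => |x|) '' fuzzyLevel (𝒳 ω).mem 0)) P

/-- Fuzzy Tukey depth. -/
def DFT {Ω : Type*} [MeasurableSpace Ω] (P : Measure Ω) (𝒳 : Ω → FuzzyNumber)
    (A : FuzzyNumber) : ℝ≥0∞ :=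
  ⨅ u ∈ ({-1, 1} : Set ℝ), ⨅ α ∈ Set.Icc (0:ℝ) 1,
    min (P {ω | suppFn (𝒳 ω) u α ≤ suppFn A u α})
        (P {ω | suppFn A u α ≤ suppFn (𝒳 ω) u α})

/-- Midpoint median of a real random variable. -/
def medMid {Ω : Type*} [MeasurableSpace Ω] (P : Measure Ω) (Y : Ω → ℝ) : ℝ :=
  (sInf (MedSet P Y) + sSup (MedSet P Y)) / 2

/-- Median absolute deviation. -/
def MAD {Ω : Type*} [MeasurableSpace Ω] (P : Measure Ω) (Y : Ω → ℝ) : ℝ :=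
  medMid P (fun ω => |Y ω - medMid P Y|)

/-- Outlyingness function. -/
def outly {Ω : Type*} [MeasurableSpace Ω] (P : Measure Ω) (𝒳 : Ω → FuzzyNumber)
    (A : FuzzyNumber) : ℝ :=
  sSup {r : ℝ | ∃ u ∈ ({-1, 1} : Set ℝ), ∃ α ∈ Set.Icc (0:ℝ) 1,
    r = |suppFn A u α - medMid P (fun ω => suppFn (𝒳 ω) u α)| /
        MAD P (fun ω => suppFn (𝒳 ω) u α)}

/-- Fuzzy projection depth. -/
def DFP {Ω : Type*} [MeasurableSpace Ω] (P : Measure Ω) (𝒳 : Ω → FuzzyNumber)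
    (A : FuzzyNumber) : ℝ :=
  (1 + outly P 𝒳 A)⁻¹

/-- Uniform probability on {−1,1} (as a measure on ℝ). -/
def coinMeasure : Measure ℝ := (2:ℝ≥0∞)⁻¹ • (Measure.dirac (-1) + Measure.dirac 1)

/-- υ ⊗ ν on {−1,1} × [0,1]. -/
def baseMeasure : Measure (ℝ × ℝ) := coinMeasure.prod (volume.restrict (Set.Icc (0:ℝ) 1))

/-- Modified simplicial depth (p = 1, two independent copies). -/
def DmS {Ω : Type*} [MeasurableSpace Ω] (P : Measure Ω) (𝒳 : Ω → FuzzyNumber)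
    (A : FuzzyNumber) : ℝ :=
  ∫ ω : Ω × Ω,
    (baseMeasure {p : ℝ × ℝ |
      min (suppFn (𝒳 ω.1) p.1 p.2) (suppFn (𝒳 ω.2) p.1 p.2) ≤ suppFn A p.1 p.2 ∧
      suppFn A p.1 p.2 ≤ max (suppFn (𝒳 ω.1) p.1 p.2) (suppFn (𝒳 ω.2) p.1 p.2)}).toReal
    ∂(P.prod P)

/-- Fuzzy simplicial depth (p = 1). -/
def DFS {Ω : Type*} [MeasurableSpace Ω] (P : Measure Ω) (𝒳 : Ω → FuzzyNumber)
    (A : FuzzyNumber) : ℝ :=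
  min
    (∫ ω : Ω × Ω,
      (volume {α ∈ Set.Icc (0:ℝ) 1 |
        min (suppFn (𝒳 ω.1) 1 α) (suppFn (𝒳 ω.2) 1 α) ≤ suppFn A 1 α ∧
        suppFn A 1 α ≤ max (suppFn (𝒳 ω.1) 1 α) (suppFn (𝒳 ω.2) 1 α)}).toReal
      ∂(P.prod P))
    (∫ ω : Ω × Ω,
      (volume {α ∈ Set.Icc (0:ℝ) 1 |
        min (suppFn (𝒳 ω.1) (-1) α) (suppFn (𝒳 ω.2) (-1) α) ≤ suppFn A (-1) α ∧
        suppFn A (-1) α ≤ max (suppFn (𝒳 ω.1) (-1) α) (suppFn (𝒳 ω.2) (-1) α)}).toReal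
      ∂(P.prod P))

open Filter Topology

/-- If sets of measure at least `c` occur frequently along a countably generated filter and every
point outside `T` eventually leaves them, then `T` has measure at least `c`. -/
lemma le_measure_of_frequently {Ω ι : Type*} [MeasurableSpace Ω] {P : Measure Ω}
    [IsFiniteMeasure P] {l : Filter ι} [l.IsCountablyGenerated] {c : ℝ≥0∞}
    {S : ι → Set Ω} {T : Set Ω} (hS : ∃ᶠ i in l, MeasurableSet (S i) ∧ c ≤ P (S i))
    (hT : ∀ ω ∉ T, ∀ᶠ i in l, ω ∉ S i) : c ≤ P T := by
  obtain ⟨k, hk, hkS⟩ := exists_seq_forall_of_frequently hS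
  have hm : ∀ n, MeasurableSet (⋃ j ≥ n, S (k j)) := fun n =>
    MeasurableSet.iUnion fun j => MeasurableSet.iUnion fun _ => (hkS j).1
  have hlim := tendsto_measure_iInter_atTop (μ := P) (s := fun n : ℕ => ⋃ j ≥ n, S (k j))
    (fun n => (hm n).nullMeasurableSet)
    (fun a b hab => biUnion_mono (fun j hj => le_trans hab hj) fun _ _ => le_rfl)
    ⟨0, measure_ne_top _ _⟩
  refine (ge_of_tendsto' hlim fun n => (hkS n).2.trans
    (measure_mono (subset_biUnion_of_mem (u := fun j => S (k j)) (le_refl n)))).trans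
    (measure_mono fun ω hω => ?_)
  by_contra hωT
  obtain ⟨n, hn⟩ := eventually_atTop.1 (hk.eventually (hT ω hωT))
  obtain ⟨j, hj, hjS⟩ := mem_iUnion₂.1 (mem_iInter.1 hω n)
  exact hn j hj hjS

lemma half_le_iff_half_le_measureReal {Ω : Type*} [MeasurableSpace Ω] {P : Measure Ω}
    [IsFiniteMeasure P] {S : Set Ω} : 1 / 2 ≤ P S ↔ 1 / 2 ≤ P.real S := by
  rw [Measure.real, ← ENNReal.ofReal_le_iff_le_toReal (measure_ne_top P S)]
  norm_num [ENNReal.ofReal_div_of_pos]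

lemma integrable_abs_sub_const {Ω : Type*} [MeasurableSpace Ω] {P : Measure Ω}
    [IsFiniteMeasure P] {Y : Ω → ℝ} (hY : Integrable Y P) (c : ℝ) :
    Integrable (fun ω => |c - Y ω|) P :=
  ((integrable_const c).sub hY).abs

lemma integrable_const_mul_indicator_sub {Ω : Type*} [MeasurableSpace Ω] {P : Measure Ω}
    [IsFiniteMeasure P] {S : Set Ω} (hS : MeasurableSet S) (h : ℝ) :
    Integrable (fun ω => h * (2 * S.indicator 1 ω - 1)) P :=
  ((((integrable_const (1 : ℝ)).indicator hS).const_mul 2).sub (integrable_const 1)).const_mul h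

lemma integral_const_mul_indicator_sub {Ω : Type*} [MeasurableSpace Ω] {P : Measure Ω}
    [IsProbabilityMeasure P] {S : Set Ω} (hS : MeasurableSet S) (h : ℝ) :
    ∫ ω, h * (2 * S.indicator (1 : Ω → ℝ) ω - 1) ∂P = h * (2 * P.real S - 1) := by
  have hi : Integrable (fun ω => 2 * S.indicator (1 : Ω → ℝ) ω) P :=
    ((integrable_const (1 : ℝ)).indicator hS).const_mul 2
  rw [integral_const_mul, integral_sub hi (integrable_const 1), integral_const_mul,
    integral_indicator_one hS]
  simp

lemma integral_abs_sub_le_of_le {Ω : Type*} [MeasurableSpace Ω] {P : Measure Ω}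
    [IsProbabilityMeasure P] {Y : Ω → ℝ} (hm : Measurable Y) (hY : Integrable Y P) {m c : ℝ}
    (hmed : 1 / 2 ≤ P {ω | Y ω ≤ m}) (hmc : m ≤ c) :
    ∫ ω, |m - Y ω| ∂P ≤ ∫ ω, |c - Y ω| ∂P := by
  have hS : MeasurableSet {ω | Y ω ≤ m} := hm measurableSet_Iic
  have key : ∫ ω, (c - m) * (2 * {ω | Y ω ≤ m}.indicator (1 : Ω → ℝ) ω - 1) ∂P
      ≤ ∫ ω, (|c - Y ω| - |m - Y ω|) ∂P := by
    refine integral_mono (integrable_const_mul_indicator_sub hS _)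
      ((integrable_abs_sub_const hY c).sub (integrable_abs_sub_const hY m)) fun ω => ?_
    by_cases h : Y ω ≤ m
    · simp only [indicator, mem_ofPred_eq, h, if_true, Pi.one_apply]
      rw [abs_of_nonneg (by linarith), abs_of_nonneg (by linarith)]
      linarith
    · simp only [indicator, mem_ofPred_eq, h, if_false]
      have := abs_sub_abs_le_abs_sub (m - Y ω) (c - Y ω)
      rw [show m - Y ω - (c - Y ω) = -(c - m) by ring, abs_neg,
        abs_of_nonneg (sub_nonneg.2 hmc)] at this
      linarith
  rw [integral_const_mul_indicator_sub hS, integral_sub (integrable_abs_sub_const hY c)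
    (integrable_abs_sub_const hY m)] at key
  have h2 := half_le_iff_half_le_measureReal.1 hmed
  nlinarith [mul_nonneg (sub_nonneg.2 hmc) (by linarith : 0 ≤ 2 * P.real {ω | Y ω ≤ m} - 1)]

lemma half_le_measure_le_of_forall_integral_abs_sub_le {Ω : Type*} [MeasurableSpace Ω]
    {P : Measure Ω} [IsProbabilityMeasure P] {Y : Ω → ℝ} (hm : Measurable Y)
    (hY : Integrable Y P) {m : ℝ}
    (hmin : ∀ c, ∫ ω, |m - Y ω| ∂P ≤ ∫ ω, |c - Y ω| ∂P) : 1 / 2 ≤ P {ω | Y ω ≤ m} := by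
  have hfreq : ∀ c > m, MeasurableSet {ω | Y ω < c} ∧ 1 / 2 ≤ P {ω | Y ω < c} := by
    intro c hc
    have hS : MeasurableSet {ω | Y ω < c} := hm measurableSet_Iio
    refine ⟨hS, half_le_iff_half_le_measureReal.2 ?_⟩
    have key : ∫ ω, (|c - Y ω| - |m - Y ω|) ∂P
        ≤ ∫ ω, (c - m) * (2 * {ω | Y ω < c}.indicator (1 : Ω → ℝ) ω - 1) ∂P := by
      refine integral_mono ((integrable_abs_sub_const hY c).sub (integrable_abs_sub_const hY m))
        (integrable_const_mul_indicator_sub hS _) fun ω => ?_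
      by_cases h : Y ω < c
      · simp only [indicator, mem_ofPred_eq, h, if_true, Pi.one_apply]
        have := abs_sub_abs_le_abs_sub (c - Y ω) (m - Y ω)
        rw [show c - Y ω - (m - Y ω) = c - m by ring, abs_of_pos (sub_pos.2 hc)] at this
        linarith
      · simp only [indicator, mem_ofPred_eq, h, if_false]
        rw [abs_of_nonpos (by linarith), abs_of_nonpos (by linarith)]
        linarith
    rw [integral_const_mul_indicator_sub hS, integral_sub (integrable_abs_sub_const hY c)
      (integrable_abs_sub_const hY m)] at key
    have := nonneg_of_mul_nonneg_right ((sub_nonneg.2 (hmin c)).trans key) (sub_pos.2 hc)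
    linarith
  have hev : ∀ᶠ c in 𝓝[>] m, MeasurableSet {ω | Y ω < c} ∧ 1 / 2 ≤ P {ω | Y ω < c} := by
    filter_upwards [self_mem_nhdsWithin] with c hc using hfreq c hc
  refine le_measure_of_frequently hev.frequently fun ω hω => ?_
  have hω' : m < Y ω := not_le.1 hω
  filter_upwards [mem_nhdsWithin_of_mem_nhds (Iio_mem_nhds hω')] with c hc
  exact not_lt.2 (le_of_lt hc)

/-- The medians of an integrable random variable are the minimizers of the mean absolute
deviation. -/
lemma mem_medSet_iff_forall_integral_abs_sub_le {Ω : Type*} [MeasurableSpace Ω] {P : Measure Ω}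
    [IsProbabilityMeasure P] {Y : Ω → ℝ} (hm : Measurable Y) (hY : Integrable Y P) {m : ℝ} :
    m ∈ MedSet P Y ↔ ∀ c, ∫ ω, |m - Y ω| ∂P ≤ ∫ ω, |c - Y ω| ∂P := by
  have hneg : ∀ c : ℝ, ∫ ω, |-c - (-Y) ω| ∂P = ∫ ω, |c - Y ω| ∂P := fun c => by
    congr with ω
    rw [Pi.neg_apply, ← abs_neg]
    ring_nf
  have hset : {ω | (-Y) ω ≤ -m} = {ω | m ≤ Y ω} := by ext ω; simp
  constructor
  · rintro ⟨h1, h2⟩ c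
    rcases le_total m c with h | h
    · exact integral_abs_sub_le_of_le hm hY h1 h
    · rw [← hneg m, ← hneg c]
      exact integral_abs_sub_le_of_le hm.neg hY.neg (hset ▸ h2) (neg_le_neg h)
  · intro h
    refine ⟨half_le_measure_le_of_forall_integral_abs_sub_le hm hY h, ?_⟩
    rw [← hset]
    refine half_le_measure_le_of_forall_integral_abs_sub_le hm.neg hY.neg fun c => ?_
    rw [hneg m, ← neg_neg c, hneg (-c)]
    exact h _

lemma nonempty_medSet {Ω : Type*} [MeasurableSpace Ω] {P : Measure Ω}
    [IsProbabilityMeasure P] {Y : Ω → ℝ} (hm : Measurable Y) (hY : Integrable Y P) :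
    (MedSet P Y).Nonempty := by
  have hlip : LipschitzWith 1 fun c : ℝ => ∫ ω, |c - Y ω| ∂P := by
    refine LipschitzWith.of_le_add fun c d => ?_
    calc ∫ ω, |c - Y ω| ∂P ≤ ∫ ω, (|d - Y ω| + dist c d) ∂P := by
          refine integral_mono (integrable_abs_sub_const hY c)
            ((integrable_abs_sub_const hY d).add (integrable_const _)) fun ω => ?_
          have := abs_sub_abs_le_abs_sub (c - Y ω) (d - Y ω)
          rw [sub_sub_sub_cancel_right] at this
          rw [Real.dist_eq]
          linarith
      _ = ∫ ω, |d - Y ω| ∂P + dist c d := by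
          rw [integral_add (integrable_abs_sub_const hY d) (integrable_const _)]
          simp
  have hcoer : Tendsto (fun c : ℝ => ∫ ω, |c - Y ω| ∂P) (cocompact ℝ) atTop := by
    refine tendsto_atTop_mono (f := fun c : ℝ => ‖c‖ + -∫ ω, |Y ω| ∂P) (fun c => ?_)
      (tendsto_atTop_add_const_right _ _ (tendsto_norm_cocompact_atTop (E := ℝ)))
    have : ∫ ω, (|c| - |Y ω|) ∂P ≤ ∫ ω, |c - Y ω| ∂P :=
      integral_mono ((integrable_const _).sub hY.abs) (integrable_abs_sub_const hY c)
        fun ω => abs_sub_abs_le_abs_sub c (Y ω)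
    rw [integral_sub (integrable_const _) hY.abs] at this
    simpa [sub_eq_add_neg] using this
  obtain ⟨m, hmin⟩ := hlip.continuous.exists_forall_le hcoer
  exact ⟨m, (mem_medSet_iff_forall_integral_abs_sub_le hm hY).2 hmin⟩

lemma mem_fuzzyLevel_of_pos {A : ℝ → ℝ} {α x : ℝ} (hα : 0 < α) :
    x ∈ fuzzyLevel A α ↔ α ≤ A x := by
  simp [fuzzyLevel, hα.ne']

lemma fuzzyLevel_anti {A : ℝ → ℝ} {α β : ℝ} (hα : 0 ≤ α) (hαβ : α ≤ β) :
    fuzzyLevel A β ⊆ fuzzyLevel A α := by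
  rcases hα.eq_or_lt with rfl | hα
  · rcases hαβ.eq_or_lt with rfl | hβ
    · exact le_rfl
    · intro x hx
      rw [mem_fuzzyLevel_of_pos hβ] at hx
      simpa [fuzzyLevel] using subset_closure (show x ∈ {x | 0 < A x} from hβ.trans_le hx)
  · intro x hx
    rw [mem_fuzzyLevel_of_pos (hα.trans_le hαβ)] at hx
    exact (mem_fuzzyLevel_of_pos hα).2 (hαβ.trans hx)

lemma isGreatest_suppFn (A : FuzzyNumber) (u : ℝ) {α : ℝ} (hα : α ∈ Icc (0 : ℝ) 1) :
    IsGreatest ((fun v => u * v) '' fuzzyLevel A.mem α) (suppFn A u α) :=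
  ((A.level_compact α hα).image (continuous_const_mul u)).isGreatest_sSup
    ((A.level_nonempty α hα).image _)

lemma mul_le_suppFn (A : FuzzyNumber) (u : ℝ) {α x : ℝ} (hα : α ∈ Icc (0 : ℝ) 1)
    (hx : x ∈ fuzzyLevel A.mem α) : u * x ≤ suppFn A u α :=
  (isGreatest_suppFn A u hα).2 (mem_image_of_mem _ hx)

lemma suppFn_antitoneOn (A : FuzzyNumber) (u : ℝ) : AntitoneOn (suppFn A u) (Icc 0 1) := by
  intro α hα β hβ hαβ
  obtain ⟨x, hx, hxe⟩ := (isGreatest_suppFn A u hβ).1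
  rw [← hxe]
  exact mul_le_suppFn A u hα (fuzzyLevel_anti hα.1 hαβ hx)

lemma suppFn_add_suppFn_neg_nonneg (A : FuzzyNumber) (u : ℝ) {α : ℝ} (hα : α ∈ Icc (0 : ℝ) 1) :
    0 ≤ suppFn A u α + suppFn A (-u) α := by
  obtain ⟨x, hx⟩ := A.level_nonempty α hα
  linarith [mul_le_suppFn A u hα hx, mul_le_suppFn A (-u) hα hx]

lemma abs_suppFn_le (A : FuzzyNumber) {u α : ℝ} (hu : u ∈ ({-1, 1} : Set ℝ))
    (hα : α ∈ Icc (0 : ℝ) 1) :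
    |suppFn A u α| ≤ sSup ((fun x => |x|) '' fuzzyLevel A.mem 0) := by
  obtain ⟨x, hx, hxe⟩ := (isGreatest_suppFn A u hα).1
  have habs : |suppFn A u α| = |x| := by
    rw [← hxe]
    rcases hu with rfl | rfl <;> simp
  rw [habs]
  exact le_csSup ((A.level_compact 0 (by simp)).image continuous_abs).bddAbove
    (mem_image_of_mem _ (fuzzyLevel_anti le_rfl hα.1 hx))

/-- Punctured one-sided neighbourhoods along which support functions are continuous: from the left
at positive levels, from the right at level `0`. -/
def levelFilter (α : ℝ) : Filter ℝ :=
  if α = 0 then 𝓝[>] 0 else 𝓝[<] α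

instance (α : ℝ) : (levelFilter α).IsCountablyGenerated := by
  unfold levelFilter
  split_ifs <;> infer_instance

lemma Icc_mem_levelFilter {α : ℝ} (hα : α ∈ Icc (0 : ℝ) 1) : Icc 0 1 ∈ levelFilter α := by
  unfold levelFilter
  split_ifs with h
  · exact mem_of_superset (Ioc_mem_nhdsGT zero_lt_one) Ioc_subset_Icc_self
  · exact mem_of_superset (Ico_mem_nhdsLT (lt_of_le_of_ne hα.1 (Ne.symm h)))
      (Ico_subset_Icc_self.trans (Icc_subset_Icc_right hα.2))

lemma exists_Ioo_subset_of_mem_levelFilter {α : ℝ} {S : Set ℝ} (hS : S ∈ levelFilter α) :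
    ∃ a b, a < b ∧ Ioo a b ⊆ S := by
  unfold levelFilter at hS
  split_ifs at hS
  · obtain ⟨b, hb, h⟩ := mem_nhdsGT_iff_exists_Ioo_subset.1 hS
    exact ⟨0, b, hb, h⟩
  · obtain ⟨a, ha, h⟩ := mem_nhdsLT_iff_exists_Ioo_subset.1 hS
    exact ⟨a, α, ha, h⟩

lemma frequently_levelFilter_of_ae {α : ℝ} (hα : α ∈ Icc (0 : ℝ) 1) {G : ℝ → Prop}
    (hG : ∀ᵐ β ∂volume.restrict (Ioc (0 : ℝ) 1), G β) : ∃ᶠ β in levelFilter α, G β := by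
  intro hev
  obtain ⟨a, b, hab, hsub⟩ :=
    exists_Ioo_subset_of_mem_levelFilter (inter_mem hev (Icc_mem_levelFilter hα))
  have h0 : volume.restrict (Icc (0 : ℝ) 1) (Ioo a b) = 0 := by
    rw [← restrict_Ioc_eq_restrict_Icc]
    exact measure_mono_null (fun x hx => (hsub hx).1) (ae_iff.1 hG)
  rw [Measure.restrict_eq_self _ fun x hx => (hsub hx).2, Real.volume_Ioo] at h0
  exact absurd h0 (by simpa using hab)

lemma tendsto_suppFn_levelFilter (A : FuzzyNumber) {u α : ℝ} (hu : u ∈ ({-1, 1} : Set ℝ))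
    (hα : α ∈ Icc (0 : ℝ) 1) :
    Tendsto (suppFn A u) (levelFilter α) (𝓝 (suppFn A u α)) := by
  have huu : ∀ y, u * (u * y) = y := by rcases hu with rfl | rfl <;> simp
  rw [tendsto_order]
  by_cases h : α = 0
  · subst h
    refine ⟨fun y hy => ?_, fun y hy => ?_⟩
    · obtain ⟨x, hx, hxe⟩ := (isGreatest_suppFn A u hα).1
      have hopen : IsOpen {z : ℝ | y < u * z} := isOpen_lt continuous_const
        (continuous_const_mul u)
      have hx' : x ∈ closure {x | 0 < A.mem x} := by simpa [fuzzyLevel] using hx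
      obtain ⟨z, hz, hzA⟩ := mem_closure_iff.1 hx' _ hopen (show y < u * x from hy.trans_eq hxe.symm)
      have hz0 : 0 < A.mem z := hzA
      filter_upwards [Icc_mem_levelFilter hα,
        show Ioc 0 (A.mem z) ∈ levelFilter 0 by
          simpa [levelFilter] using Ioc_mem_nhdsGT hz0] with β hβ hβ'
      exact lt_of_lt_of_le hz (mul_le_suppFn A u hβ ((mem_fuzzyLevel_of_pos hβ'.1).2 hβ'.2))
    · filter_upwards [Icc_mem_levelFilter hα] with β hβ
      exact (suppFn_antitoneOn A u hα hβ hβ.1).trans_lt hy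
  · have hα0 : 0 < α := lt_of_le_of_ne hα.1 (Ne.symm h)
    have hle : ∀ {r}, r < α → Ioo r α ∈ levelFilter α := fun hr => by
      simpa [levelFilter, h] using Ioo_mem_nhdsLT hr
    refine ⟨fun y hy => ?_, fun y hy => ?_⟩
    · filter_upwards [Icc_mem_levelFilter hα, hle hα0] with β hβ hβ'
      exact hy.trans_le (suppFn_antitoneOn A u hβ hα hβ'.2.le)
    · have hnot : A.mem (u * y) < α := by
        by_contra! hc
        have := mul_le_suppFn A u hα ((mem_fuzzyLevel_of_pos hα0).2 hc)
        rw [huu] at this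
        linarith
      filter_upwards [Icc_mem_levelFilter hα, hle hα0, hle hnot] with β hβ hβ0 hβ'
      by_contra! hc
      obtain ⟨p, hp, hpe⟩ := (isGreatest_suppFn A u hα).1
      obtain ⟨q, hq, hqe⟩ := (isGreatest_suppFn A u hβ).1
      have hp' := fuzzyLevel_anti hβ.1 hβ0.2.le hp
      have hmem : u * y ∈ fuzzyLevel A.mem β := by
        have hord := (A.level_convex β hβ).ordConnected
        simp only at hpe hqe
        rcases hu with rfl | rfl
        · exact hord.out hq hp' ⟨by linarith, by linarith⟩
        · exact hord.out hp' hq ⟨by linarith, by linarith⟩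
      exact absurd ((mem_fuzzyLevel_of_pos hβ0.1).1 hmem) (not_le.2 hβ'.1)

section FuzzyRandomNumber

variable {Ω : Type*} [MeasurableSpace Ω] {P : Measure Ω} {𝒳 : Ω → FuzzyNumber}

lemma integrable_suppFn (hmeas : SuppMeasurable 𝒳) (hL1 : FuzzyL1 P 𝒳) {u α : ℝ}
    (hu : u ∈ ({-1, 1} : Set ℝ)) (hα : α ∈ Icc (0 : ℝ) 1) :
    Integrable (fun ω => suppFn (𝒳 ω) u α) P :=
  hL1.mono' (hmeas u hu α hα).aestronglyMeasurable
    (Eventually.of_forall fun ω => abs_suppFn_le (𝒳 ω) hu hα)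

/-- The `α`-level of the largest support median: the points lying below the upper median of
`s_𝒳(u,α)` in each direction `u`. -/
def medianLevel (P : Measure Ω) (𝒳 : Ω → FuzzyNumber) (α : ℝ) : Set ℝ :=
  {x | ∀ u ∈ ({-1, 1} : Set ℝ), 1 / 2 ≤ P {ω | u * x ≤ suppFn (𝒳 ω) u α}}

lemma medianLevel_anti {α β : ℝ} (hα : α ∈ Icc (0 : ℝ) 1) (hβ : β ∈ Icc (0 : ℝ) 1)
    (hαβ : α ≤ β) : medianLevel P 𝒳 β ⊆ medianLevel P 𝒳 α := fun _ hx u hu =>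
  (hx u hu).trans (measure_mono fun ω hω => le_trans hω (suppFn_antitoneOn (𝒳 ω) u hα hβ hαβ))

lemma ordConnected_medianLevel (α : ℝ) : (medianLevel P 𝒳 α).OrdConnected := by
  refine ⟨fun x hx y hy z hz u hu => ?_⟩
  rcases hu with rfl | rfl
  · exact (hx (-1) (by simp)).trans (measure_mono fun ω hω =>
      le_trans (show -1 * z ≤ -1 * x by linarith [hz.1]) hω)
  · exact (hy 1 (by simp)).trans (measure_mono fun ω hω =>
      le_trans (show 1 * z ≤ 1 * y by linarith [hz.2]) hω)

lemma isClosed_medianLevel [IsFiniteMeasure P] (hmeas : SuppMeasurable 𝒳) {α : ℝ}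
    (hα : α ∈ Icc (0 : ℝ) 1) : IsClosed (medianLevel P 𝒳 α) := by
  refine isClosed_of_closure_subset fun x hx u hu => ?_
  refine le_measure_of_frequently (l := 𝓝 x) (S := fun y => {ω | u * y ≤ suppFn (𝒳 ω) u α})
    ((mem_closure_iff_frequently.1 hx).mono fun y hy =>
      ⟨hmeas u hu α hα measurableSet_Ici, hy u hu⟩) fun ω hω => ?_
  have hω' : suppFn (𝒳 ω) u α < u * x := not_le.1 hω
  filter_upwards [(continuous_const_mul u).continuousAt.eventually (lt_mem_nhds hω')] with y hy
  exact not_le.2 hy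

lemma medianLevel_subset_Icc [IsProbabilityMeasure P] (hL1 : FuzzyL1 P 𝒳) {α : ℝ} (hα : α ∈ Icc (0 : ℝ) 1) :
    medianLevel P 𝒳 α ⊆
      Icc (-(2 * ∫ ω, sSup ((fun x => |x|) '' fuzzyLevel (𝒳 ω).mem 0) ∂P))
        (2 * ∫ ω, sSup ((fun x => |x|) '' fuzzyLevel (𝒳 ω).mem 0) ∂P) := by
  intro x hx
  have key : ∀ u ∈ ({-1, 1} : Set ℝ),
      u * x ≤ 2 * ∫ ω, sSup ((fun x => |x|) '' fuzzyLevel (𝒳 ω).mem 0) ∂P := by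
    intro u hu
    have hN : ∀ ω, |suppFn (𝒳 ω) u α| ≤ sSup ((fun x => |x|) '' fuzzyLevel (𝒳 ω).mem 0) :=
      fun ω => abs_suppFn_le (𝒳 ω) hu hα
    have hN0 : 0 ≤ ∫ ω, sSup ((fun x => |x|) '' fuzzyLevel (𝒳 ω).mem 0) ∂P :=
      integral_nonneg fun ω => (abs_nonneg _).trans (hN ω)
    rcases le_or_gt (u * x) 0 with h | h
    · linarith
    have h1 := mul_meas_ge_le_integral_of_nonneg (μ := P)
      (Eventually.of_forall fun ω => (abs_nonneg _).trans (hN ω)) hL1 (u * x)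
    have h2 := half_le_iff_half_le_measureReal.1 (hx u hu)
    have h3 : P.real {ω | u * x ≤ suppFn (𝒳 ω) u α} ≤
        P.real {ω | u * x ≤ sSup ((fun x => |x|) '' fuzzyLevel (𝒳 ω).mem 0)} :=
      measureReal_mono fun ω hω => le_trans hω ((le_abs_self _).trans (hN ω))
    nlinarith [mul_le_mul_of_nonneg_left (h2.trans h3) h.le]
  exact ⟨by linarith [key (-1) (by simp)], by linarith [key 1 (by simp)]⟩

lemma mul_mem_medianLevel {u α m : ℝ} (hu : u ∈ ({-1, 1} : Set ℝ)) (hα : α ∈ Icc (0 : ℝ) 1)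
    (hm : m ∈ MedSet P fun ω => suppFn (𝒳 ω) u α) : u * m ∈ medianLevel P 𝒳 α := by
  have huu : u * (u * m) = m := by rcases hu with rfl | rfl <;> simp
  intro v hv
  have hvu : v = u ∨ v = -u := by
    rcases hu with rfl | rfl <;> rcases hv with rfl | rfl <;> simp
  rcases hvu with rfl | rfl
  · rw [huu]
    exact hm.2
  · rw [neg_mul, huu]
    refine hm.1.trans (measure_mono fun ω hω => ?_)
    have hω' : suppFn (𝒳 ω) u α ≤ m := hω
    show -m ≤ suppFn (𝒳 ω) (-u) α
    linarith [suppFn_add_suppFn_neg_nonneg (𝒳 ω) u hα]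

lemma nonempty_medianLevel [IsProbabilityMeasure P] (hmeas : SuppMeasurable 𝒳)
    (hL1 : FuzzyL1 P 𝒳) {α : ℝ} (hα : α ∈ Icc (0 : ℝ) 1) : (medianLevel P 𝒳 α).Nonempty := by
  obtain ⟨m, hm⟩ := nonempty_medSet (P := P) (hmeas 1 (by simp) α hα)
    (integrable_suppFn hmeas hL1 (by simp) hα)
  exact ⟨_, mul_mem_medianLevel (by simp) hα hm⟩

lemma mem_medianLevel_of_frequently [IsFiniteMeasure P] (hmeas : SuppMeasurable 𝒳) {α x : ℝ}
    (hα : α ∈ Icc (0 : ℝ) 1) (hx : ∃ᶠ β in levelFilter α, x ∈ medianLevel P 𝒳 β) :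
    x ∈ medianLevel P 𝒳 α := by
  intro u hu
  refine le_measure_of_frequently (l := levelFilter α)
    (S := fun β => {ω | u * x ≤ suppFn (𝒳 ω) u β})
    ((hx.and_eventually (Icc_mem_levelFilter hα)).mono fun β hβ =>
      ⟨hmeas u hu β hβ.2 measurableSet_Ici, hβ.1 u hu⟩) fun ω hω => ?_
  filter_upwards [(tendsto_suppFn_levelFilter (𝒳 ω) hu hα).eventually_lt_const (not_le.1 hω)]
    with β hβ
  exact not_le.2 hβ

/-- The set of levels whose `medianLevel` contains `x`, together with level `0`. -/
def medianLevelsAt (P : Measure Ω) (𝒳 : Ω → FuzzyNumber) (x : ℝ) : Set ℝ :=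
  {α ∈ Icc (0 : ℝ) 1 | α = 0 ∨ x ∈ medianLevel P 𝒳 α}

lemma bddAbove_medianLevelsAt (x : ℝ) : BddAbove (medianLevelsAt P 𝒳 x) :=
  ⟨1, fun _ h => h.1.2⟩

lemma zero_mem_medianLevelsAt (x : ℝ) : (0 : ℝ) ∈ medianLevelsAt P 𝒳 x := by
  simp [medianLevelsAt]

lemma le_sSup_medianLevelsAt_iff [IsFiniteMeasure P] (hmeas : SuppMeasurable 𝒳) {α x : ℝ}
    (hα : α ∈ Ioc (0 : ℝ) 1) :
    α ≤ sSup (medianLevelsAt P 𝒳 x) ↔ x ∈ medianLevel P 𝒳 α := by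
  have hα' := Ioc_subset_Icc_self hα
  refine ⟨fun h => ?_, fun h => le_csSup (bddAbove_medianLevelsAt x) ⟨hα', Or.inr h⟩⟩
  have : ∀ᶠ β in levelFilter α, x ∈ medianLevel P 𝒳 β := by
    rw [levelFilter, if_neg hα.1.ne']
    filter_upwards [Ioo_mem_nhdsLT hα.1] with β hβ
    obtain ⟨γ, ⟨hγ, hγx⟩, hβγ⟩ :=
      exists_lt_of_lt_csSup ⟨0, zero_mem_medianLevelsAt x⟩ (hβ.2.trans_le h)
    exact medianLevel_anti ⟨hβ.1.le, hβ.2.le.trans hα.2⟩ hγ hβγ.le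
      (hγx.resolve_left (hβ.1.trans hβγ).ne')
  have hne : (levelFilter α).NeBot := by
    rw [levelFilter, if_neg hα.1.ne']
    infer_instance
  exact mem_medianLevel_of_frequently hmeas hα' this.frequently

lemma fuzzyLevel_sSup_medianLevelsAt [IsFiniteMeasure P] (hmeas : SuppMeasurable 𝒳) {α : ℝ}
    (hα : α ∈ Ioc (0 : ℝ) 1) :
    fuzzyLevel (fun x => sSup (medianLevelsAt P 𝒳 x)) α = medianLevel P 𝒳 α := by
  ext x
  rw [mem_fuzzyLevel_of_pos hα.1, le_sSup_medianLevelsAt_iff hmeas hα]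

lemma sSup_medianLevelsAt_mem_Icc (x : ℝ) : sSup (medianLevelsAt P 𝒳 x) ∈ Icc (0 : ℝ) 1 :=
  ⟨le_csSup (bddAbove_medianLevelsAt x) (zero_mem_medianLevelsAt x),
    csSup_le ⟨0, zero_mem_medianLevelsAt x⟩ fun _ h => h.1.2⟩

/-- The largest support median of an integrable fuzzy random number. -/
def medianFuzzyNumber [IsProbabilityMeasure P] (hmeas : SuppMeasurable 𝒳) (hL1 : FuzzyL1 P 𝒳) :
    FuzzyNumber where
  mem x := sSup (medianLevelsAt P 𝒳 x)
  mem_range := sSup_medianLevelsAt_mem_Icc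
  level_nonempty α hα := by
    have h1 := nonempty_medianLevel (P := P) hmeas hL1 (right_mem_Icc.2 zero_le_one)
    rw [← fuzzyLevel_sSup_medianLevelsAt hmeas (by simp)] at h1
    exact h1.mono (fuzzyLevel_anti hα.1 hα.2)
  level_compact α hα := by
    rcases hα.1.eq_or_lt with rfl | h0
    · rw [fuzzyLevel, if_pos rfl]
      have hsub : {x | 0 < sSup (medianLevelsAt P 𝒳 x)} ⊆
          Icc (-(2 * ∫ ω, sSup ((fun x => |x|) '' fuzzyLevel (𝒳 ω).mem 0) ∂P))
            (2 * ∫ ω, sSup ((fun x => |x|) '' fuzzyLevel (𝒳 ω).mem 0) ∂P) := fun x hx =>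
        medianLevel_subset_Icc hL1 (sSup_medianLevelsAt_mem_Icc x)
          ((le_sSup_medianLevelsAt_iff hmeas ⟨hx, (sSup_medianLevelsAt_mem_Icc x).2⟩).1 le_rfl)
      exact isCompact_Icc.of_isClosed_subset isClosed_closure (closure_minimal hsub isClosed_Icc)
    · rw [fuzzyLevel_sSup_medianLevelsAt hmeas ⟨h0, hα.2⟩]
      exact isCompact_Icc.of_isClosed_subset (isClosed_medianLevel hmeas hα)
        (medianLevel_subset_Icc hL1 hα)
  level_convex α hα := by
    have hpos : ∀ {α : ℝ}, α ∈ Ioc (0 : ℝ) 1 →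
        OrdConnected (fuzzyLevel (fun x => sSup (medianLevelsAt P 𝒳 x)) α) := fun hα => by
      rw [fuzzyLevel_sSup_medianLevelsAt hmeas hα]
      exact ordConnected_medianLevel _
    rcases hα.1.eq_or_lt with rfl | h0
    · rw [fuzzyLevel, if_pos rfl]
      refine Convex.closure (OrdConnected.convex ⟨fun x hx y hy z hz => ?_⟩)
      have hxy : 0 < min (sSup (medianLevelsAt P 𝒳 x)) (sSup (medianLevelsAt P 𝒳 y)) :=
        lt_min hx hy
      have hord := hpos ⟨hxy, (min_le_left _ _).trans (sSup_medianLevelsAt_mem_Icc x).2⟩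
      exact hxy.trans_le ((mem_fuzzyLevel_of_pos hxy).1 (hord.out
        ((mem_fuzzyLevel_of_pos hxy).2 (min_le_left _ _))
        ((mem_fuzzyLevel_of_pos hxy).2 (min_le_right _ _)) hz))
    · exact (hpos ⟨h0, hα.2⟩).convex

lemma suppFn_medianFuzzyNumber_mem_medSet [IsProbabilityMeasure P] (hmeas : SuppMeasurable 𝒳)
    (hL1 : FuzzyL1 P 𝒳) {u α : ℝ} (hu : u ∈ ({-1, 1} : Set ℝ)) (hα : α ∈ Ioc (0 : ℝ) 1) :
    suppFn (medianFuzzyNumber hmeas hL1) u α ∈ MedSet P fun ω => suppFn (𝒳 ω) u α := by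
  have hα' := Ioc_subset_Icc_self hα
  have hlevel : fuzzyLevel (medianFuzzyNumber hmeas hL1).mem α = medianLevel P 𝒳 α :=
    fuzzyLevel_sSup_medianLevelsAt hmeas hα
  obtain ⟨x, hx, hxe⟩ := (isGreatest_suppFn (medianFuzzyNumber hmeas hL1) u hα').1
  refine ⟨?_, ?_⟩
  · obtain ⟨m, hm⟩ := nonempty_medSet (P := P) (hmeas u hu α hα')
      (integrable_suppFn hmeas hL1 hu hα')
    have hle := mul_le_suppFn (medianFuzzyNumber hmeas hL1) u hα'
      (hlevel.symm ▸ mul_mem_medianLevel hu hα' hm)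
    have huu : u * (u * m) = m := by rcases hu with rfl | rfl <;> simp
    rw [huu] at hle
    exact hm.1.trans (measure_mono fun ω hω => le_trans hω hle)
  · rw [hlevel] at hx
    rw [← hxe]
    exact hx u hu

/-- The mean distance, at level `α` and summed over both directions, between the support functions
of `V` and of `𝒳`. -/
def meanSuppDist (P : Measure Ω) (𝒳 : Ω → FuzzyNumber) (V : FuzzyNumber) (α : ℝ) : ℝ :=
  ∫ ω, (|suppFn V 1 α - suppFn (𝒳 ω) 1 α| + |suppFn V (-1) α - suppFn (𝒳 ω) (-1) α|) ∂P

lemma meanSuppDist_eq_add [IsFiniteMeasure P] (hmeas : SuppMeasurable 𝒳) (hL1 : FuzzyL1 P 𝒳)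
    (V : FuzzyNumber) {α : ℝ} (hα : α ∈ Icc (0 : ℝ) 1) :
    meanSuppDist P 𝒳 V α = ∫ ω, |suppFn V 1 α - suppFn (𝒳 ω) 1 α| ∂P
      + ∫ ω, |suppFn V (-1) α - suppFn (𝒳 ω) (-1) α| ∂P :=
  integral_add (integrable_abs_sub_const (integrable_suppFn hmeas hL1 (by simp) hα) _)
    (integrable_abs_sub_const (integrable_suppFn hmeas hL1 (by simp) hα) _)

lemma integrable_abs_suppFn_sub_prod [IsFiniteMeasure P] (hjoint : JointlyMeasurable 𝒳)
    (hL1 : FuzzyL1 P 𝒳) (V : FuzzyNumber) {u : ℝ} (hu : u ∈ ({-1, 1} : Set ℝ)) :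
    Integrable (fun p : ℝ × Ω => |suppFn V u p.1 - suppFn (𝒳 p.2) u p.1|)
      ((volume.restrict (Ioc (0 : ℝ) 1)).prod P) := by
  have hV : Measurable fun p : ℝ × Ω => suppFn V u (projIcc (0 : ℝ) 1 zero_le_one p.1) := by
    have : Antitone fun a : ℝ => suppFn V u (projIcc (0 : ℝ) 1 zero_le_one a) := fun a b hab =>
      suppFn_antitoneOn V u (projIcc _ _ _ a).2 (projIcc _ _ _ b).2 (monotone_projIcc _ hab)
    exact this.measurable.comp measurable_fst
  have hX : Measurable fun p : ℝ × Ω =>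
      suppFn (𝒳 p.2) u (projIcc (0 : ℝ) 1 zero_le_one p.1) :=
    hjoint.comp (f := fun p : ℝ × Ω =>
      ((⟨u, hu⟩, projIcc (0 : ℝ) 1 zero_le_one p.1, p.2) :
        ({-1, 1} : Set ℝ) × (Icc (0 : ℝ) 1) × Ω))
      (measurable_const.prodMk
        ((continuous_projIcc.measurable.comp measurable_fst).prodMk measurable_snd))
  have hbound : Integrable (fun p : ℝ × Ω => sSup ((fun x => |x|) '' fuzzyLevel V.mem 0)
      + sSup ((fun x => |x|) '' fuzzyLevel (𝒳 p.2).mem 0))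
      ((volume.restrict (Ioc (0 : ℝ) 1)).prod P) :=
    (integrable_const _).add (hL1.comp_snd _)
  have hclamp : Integrable (fun p : ℝ × Ω =>
      |suppFn V u (projIcc (0 : ℝ) 1 zero_le_one p.1)
        - suppFn (𝒳 p.2) u (projIcc (0 : ℝ) 1 zero_le_one p.1)|)
      ((volume.restrict (Ioc (0 : ℝ) 1)).prod P) := by
    refine hbound.mono' ((hV.sub hX).abs).aestronglyMeasurable (Eventually.of_forall fun p => ?_)
    rw [Real.norm_eq_abs, abs_abs]
    exact (abs_sub _ _).trans (add_le_add (abs_suppFn_le V hu (projIcc _ _ _ p.1).2)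
      (abs_suppFn_le (𝒳 p.2) hu (projIcc _ _ _ p.1).2))
  refine hclamp.congr ?_
  have hmem : ∀ᵐ α ∂volume.restrict (Ioc (0 : ℝ) 1), α ∈ Ioc (0 : ℝ) 1 :=
    ae_restrict_mem measurableSet_Ioc
  filter_upwards [Measure.quasiMeasurePreserving_fst.ae hmem] with p hp
  rw [projIcc_of_mem zero_le_one (Ioc_subset_Icc_self hp)]

lemma integrable_suppDist_prod [IsFiniteMeasure P] (hjoint : JointlyMeasurable 𝒳)
    (hL1 : FuzzyL1 P 𝒳) (V : FuzzyNumber) :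
    Integrable (fun p : ℝ × Ω => |suppFn V 1 p.1 - suppFn (𝒳 p.2) 1 p.1|
      + |suppFn V (-1) p.1 - suppFn (𝒳 p.2) (-1) p.1|)
      ((volume.restrict (Ioc (0 : ℝ) 1)).prod P) :=
  (integrable_abs_suppFn_sub_prod hjoint hL1 V (by simp)).add
    (integrable_abs_suppFn_sub_prod hjoint hL1 V (by simp))

lemma integrable_meanSuppDist [IsFiniteMeasure P] (hjoint : JointlyMeasurable 𝒳)
    (hL1 : FuzzyL1 P 𝒳) (V : FuzzyNumber) :
    Integrable (meanSuppDist P 𝒳 V) (volume.restrict (Ioc (0 : ℝ) 1)) :=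
  (integrable_suppDist_prod hjoint hL1 V).integral_prod_left

lemma integral_rho1 [IsFiniteMeasure P] (hjoint : JointlyMeasurable 𝒳)
    (hL1 : FuzzyL1 P 𝒳) (V : FuzzyNumber) :
    ∫ ω, rho1 V (𝒳 ω) ∂P = (1 / 2) * ∫ α in Ioc (0 : ℝ) 1, meanSuppDist P 𝒳 V α := by
  simp only [rho1, intervalIntegral.integral_of_le (zero_le_one' ℝ)]
  rw [integral_const_mul]
  congr 1
  exact (integral_integral_swap (f := fun (α : ℝ) ω => |suppFn V 1 α - suppFn (𝒳 ω) 1 α|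
    + |suppFn V (-1) α - suppFn (𝒳 ω) (-1) α|) (integrable_suppDist_prod hjoint hL1 V)).symm

lemma isSupportMedian_of_ae [IsFiniteMeasure P] (hmeas : SuppMeasurable 𝒳) {A : FuzzyNumber}
    (hA : ∀ᵐ α ∂volume.restrict (Ioc (0 : ℝ) 1), ∀ u ∈ ({-1, 1} : Set ℝ),
      suppFn A u α ∈ MedSet P fun ω => suppFn (𝒳 ω) u α) : IsSupportMedian P 𝒳 A := by
  intro u hu α hα
  have hfreq := (frequently_levelFilter_of_ae hα hA).and_eventually (Icc_mem_levelFilter hα)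
  have hlim := tendsto_suppFn_levelFilter A hu hα
  refine ⟨le_measure_of_frequently (l := levelFilter α)
    (S := fun β => {ω | suppFn (𝒳 ω) u β ≤ suppFn A u β}) (hfreq.mono fun β hβ =>
      ⟨hmeas u hu β hβ.2 measurableSet_Iic, (hβ.1 u hu).1⟩) fun ω hω => ?_,
    le_measure_of_frequently (l := levelFilter α)
    (S := fun β => {ω | suppFn A u β ≤ suppFn (𝒳 ω) u β}) (hfreq.mono fun β hβ =>
      ⟨hmeas u hu β hβ.2 measurableSet_Ici, (hβ.1 u hu).2⟩) fun ω hω => ?_⟩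
  · filter_upwards [hlim.eventually_lt (tendsto_suppFn_levelFilter (𝒳 ω) hu hα) (not_le.1 hω)]
      with β hβ using not_le.2 hβ
  · filter_upwards [(tendsto_suppFn_levelFilter (𝒳 ω) hu hα).eventually_lt hlim (not_le.1 hω)]
      with β hβ using not_le.2 hβ

end FuzzyRandomNumber

/-- For `𝒳 ∈ L¹`, the 1-medians (minimizers of `U ↦ E[ρ₁(U,𝒳)]`) are exactly the
support medians of `𝒳`. -/
theorem one_median_iff_support_median
    {Ω : Type*} [MeasurableSpace Ω] (P : Measure Ω) [IsProbabilityMeasure P]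
    (𝒳 : Ω → FuzzyNumber) (hmeas : SuppMeasurable 𝒳) (hjoint : JointlyMeasurable 𝒳)
    (hL1 : FuzzyL1 P 𝒳) (A : FuzzyNumber) :
    (∀ U : FuzzyNumber, ∫ ω, rho1 A (𝒳 ω) ∂P ≤ ∫ ω, rho1 U (𝒳 ω) ∂P) ↔
      IsSupportMedian P 𝒳 A := by
  have hiff : ∀ {u α : ℝ}, u ∈ ({-1, 1} : Set ℝ) → α ∈ Icc (0 : ℝ) 1 → ∀ {m : ℝ},
      m ∈ MedSet P (fun ω => suppFn (𝒳 ω) u α) ↔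
        ∀ c, ∫ ω, |m - suppFn (𝒳 ω) u α| ∂P ≤ ∫ ω, |c - suppFn (𝒳 ω) u α| ∂P :=
    fun hu hα => mem_medSet_iff_forall_integral_abs_sub_le (hmeas _ hu _ hα)
      (integrable_suppFn hmeas hL1 hu hα)
  have hle : ∀ {V W : FuzzyNumber} {α : ℝ}, α ∈ Icc (0 : ℝ) 1 →
      (∀ u ∈ ({-1, 1} : Set ℝ), suppFn V u α ∈ MedSet P fun ω => suppFn (𝒳 ω) u α) →
      meanSuppDist P 𝒳 V α ≤ meanSuppDist P 𝒳 W α := fun hα hV => by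
    rw [meanSuppDist_eq_add hmeas hL1 _ hα, meanSuppDist_eq_add hmeas hL1 _ hα]
    exact add_le_add ((hiff (by simp) hα).1 (hV 1 (by simp)) _)
      ((hiff (by simp) hα).1 (hV (-1) (by simp)) _)
  constructor
  · intro hmin
    set U := medianFuzzyNumber hmeas hL1
    have hUmed : ∀ {α : ℝ}, α ∈ Ioc (0 : ℝ) 1 → ∀ u ∈ ({-1, 1} : Set ℝ),
        suppFn U u α ∈ MedSet P fun ω => suppFn (𝒳 ω) u α := fun hα u hu =>
      suppFn_medianFuzzyNumber_mem_medSet hmeas hL1 hu hα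
    have hae : meanSuppDist P 𝒳 U ≤ᵐ[volume.restrict (Ioc (0 : ℝ) 1)] meanSuppDist P 𝒳 A := by
      filter_upwards [ae_restrict_mem measurableSet_Ioc] with α hα
      exact hle (Ioc_subset_Icc_self hα) (hUmed hα)
    have hint : ∫ α in Ioc (0 : ℝ) 1, meanSuppDist P 𝒳 U α =
        ∫ α in Ioc (0 : ℝ) 1, meanSuppDist P 𝒳 A α := by
      refine le_antisymm (integral_mono_ae (integrable_meanSuppDist hjoint hL1 U)
        (integrable_meanSuppDist hjoint hL1 A) hae) ?_
      have := hmin U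
      rw [integral_rho1 hjoint hL1, integral_rho1 hjoint hL1] at this
      linarith
    have heq := (integral_eq_iff_of_ae_le (integrable_meanSuppDist hjoint hL1 U)
      (integrable_meanSuppDist hjoint hL1 A) hae).1 hint
    refine isSupportMedian_of_ae hmeas ?_
    filter_upwards [heq, ae_restrict_mem measurableSet_Ioc] with α hα hα01
    have hα' := Ioc_subset_Icc_self hα01
    rw [meanSuppDist_eq_add hmeas hL1 _ hα', meanSuppDist_eq_add hmeas hL1 _ hα'] at hα
    have h1 := (hiff (by simp) hα').1 (hUmed hα01 1 (by simp))
    have h2 := (hiff (by simp) hα').1 (hUmed hα01 (-1) (by simp))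
    have h1A := h1 (suppFn A 1 α)
    have h2A := h2 (suppFn A (-1) α)
    rintro u (rfl | rfl)
    · exact (hiff (by simp) hα').2 fun c => (by linarith [h2 c])
    · exact (hiff (by simp) hα').2 fun c => (by linarith [h1 c])
  · intro hA U
    rw [integral_rho1 hjoint hL1, integral_rho1 hjoint hL1]
    refine mul_le_mul_of_nonneg_left (setIntegral_mono_on (integrable_meanSuppDist hjoint hL1 A)
      (integrable_meanSuppDist hjoint hL1 U) measurableSet_Ioc fun α hα => ?_) (by norm_num)
    exact hle (Ioc_subset_Icc_self hα) fun u hu => hA u hu α (Ioc_subset_Icc_self hα)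

end
end

section
/- Let 𝒳 be an arbitrary fuzzy random number (no integrability assumption). Then Med_s(𝒳) = Med(𝒳;D_FT): a fuzzy number A satisfies s_A(u,α) ∈ Med(s_𝒳(u,α)) for all u ∈ {−1,1} and α ∈ [0,1] if and only if A maximizes the fuzzy Tukey depth D_FT(·;𝒳) over F_c(ℝ). -/
open MeasureTheory Set ENNReal

noncomputable section

section Auxiliary

open Filter Topology

namespace FuzzyNumber

theorem bddAbove_image_level (A : FuzzyNumber) (u : ℝ) {α : ℝ} (hα : α ∈ Icc (0:ℝ) 1) :
    BddAbove ((fun v => u * v) '' fuzzyLevel A.mem α) :=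
  ((A.level_compact α hα).image (continuous_const_mul u)).bddAbove

theorem mul_le_suppFn (A : FuzzyNumber) (u : ℝ) {α v : ℝ} (hα : α ∈ Icc (0:ℝ) 1)
    (hv : v ∈ fuzzyLevel A.mem α) : u * v ≤ suppFn A u α :=
  le_csSup (A.bddAbove_image_level u hα) (mem_image_of_mem _ hv)

theorem suppFn_le (A : FuzzyNumber) {u α c : ℝ} (hα : α ∈ Icc (0:ℝ) 1)
    (h : ∀ v ∈ fuzzyLevel A.mem α, u * v ≤ c) : suppFn A u α ≤ c :=
  csSup_le ((A.level_nonempty α hα).image _) (forall_mem_image.2 h)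

theorem exists_mul_eq_suppFn (A : FuzzyNumber) (u : ℝ) {α : ℝ} (hα : α ∈ Icc (0:ℝ) 1) :
    ∃ v ∈ fuzzyLevel A.mem α, u * v = suppFn A u α :=
  ((A.level_compact α hα).image (continuous_const_mul u)).sSup_mem
    ((A.level_nonempty α hα).image _)

theorem mem_level_iff {A : ℝ → ℝ} {α x : ℝ} (hα : 0 < α) :
    x ∈ fuzzyLevel A α ↔ α ≤ A x := by
  simp [fuzzyLevel, hα.ne']

theorem level_anti {A : ℝ → ℝ} {α β : ℝ} (hα : 0 ≤ α) (hαβ : α ≤ β) :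
    fuzzyLevel A β ⊆ fuzzyLevel A α := by
  intro x hx
  rcases hα.eq_or_lt with rfl | hα
  · rcases hαβ.eq_or_lt with rfl | hβ
    · exact hx
    · rw [mem_level_iff hβ] at hx
      rw [fuzzyLevel, if_pos rfl]
      exact subset_closure (hβ.trans_le hx)
  · rw [mem_level_iff (hα.trans_le hαβ)] at hx
    exact (mem_level_iff hα).2 (hαβ.trans hx)

theorem suppFn_antitoneOn (A : FuzzyNumber) (u : ℝ) : AntitoneOn (suppFn A u) (Icc 0 1) :=
  fun _ hα _ hβ hαβ => A.suppFn_le hβ fun _ hv => A.mul_le_suppFn u hα (level_anti hα.1 hαβ hv)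

theorem neg_suppFn_neg_one_le (A : FuzzyNumber) {α : ℝ} (hα : α ∈ Icc (0:ℝ) 1) :
    -suppFn A (-1) α ≤ suppFn A 1 α := by
  obtain ⟨v, hv⟩ := A.level_nonempty α hα
  linarith [A.mul_le_suppFn 1 hα hv, A.mul_le_suppFn (-1) hα hv]

/-- Left continuity of the support function, along sequences. -/
theorem le_suppFn_of_tendsto (A : FuzzyNumber) (u : ℝ) {α x : ℝ} (hα : α ∈ Icc (0:ℝ) 1)
    {b : ℕ → ℝ} (hb : Monotone b) (hb₀ : ∀ n, b n ∈ Ioc (0:ℝ) 1)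
    (hlim : Tendsto b atTop (𝓝 α)) (h : ∀ n, x ≤ suppFn A u (b n)) :
    x ≤ suppFn A u α := by
  have hcl : IsClosed {v : ℝ | x ≤ u * v} :=
    isClosed_le continuous_const (continuous_const_mul u)
  have hcomp : ∀ n, IsCompact (fuzzyLevel A.mem (b n)) := fun n =>
    A.level_compact _ (Ioc_subset_Icc_self (hb₀ n))
  obtain ⟨v, hv⟩ := IsCompact.nonempty_iInter_of_sequence_nonempty_isCompact_isClosed
    (fun n => fuzzyLevel A.mem (b n) ∩ {v : ℝ | x ≤ u * v})
    (fun n => inter_subset_inter_left _ (level_anti (hb₀ n).1.le (hb n.le_succ)))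
    (fun n => by
      obtain ⟨v, hv, hv'⟩ := A.exists_mul_eq_suppFn u (Ioc_subset_Icc_self (hb₀ n))
      exact ⟨v, hv, (h n).trans hv'.ge⟩)
    ((hcomp 0).inter_right hcl)
    (fun n => (hcomp n).isClosed.inter hcl)
  have hv := mem_iInter.1 hv
  have hαpos : 0 < α := (hb₀ 0).1.trans_le (hb.ge_of_tendsto hlim 0)
  refine (hv 0).2.trans (A.mul_le_suppFn u hα ((mem_level_iff hαpos).2 ?_))
  exact le_of_tendsto' hlim fun n => (mem_level_iff (hb₀ n).1).1 (hv n).1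

/-- Right continuity at `0` of the support function. -/
theorem suppFn_zero_le (A : FuzzyNumber) (u : ℝ) {c : ℝ}
    (h : ∀ n : ℕ, suppFn A u (1 / ((n : ℝ) + 1)) ≤ c) : suppFn A u 0 ≤ c := by
  refine A.suppFn_le ⟨le_rfl, zero_le_one⟩ fun v hv => ?_
  rw [fuzzyLevel, if_pos rfl] at hv
  refine closure_minimal (t := {v : ℝ | u * v ≤ c}) (fun w hw => ?_)
    (isClosed_le (continuous_const_mul u) continuous_const) hv
  obtain ⟨n, hn⟩ := exists_nat_one_div_lt (show (0:ℝ) < A.mem w from hw)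
  have hpos : 0 < 1 / ((n : ℝ) + 1) := Nat.one_div_pos_of_nat
  exact (A.mul_le_suppFn u ⟨hpos.le, hn.le.trans (A.mem_range w).2⟩
    ((mem_level_iff hpos).2 hn.le)).trans (h n)

/-- A left-continuous nested family of intervals `[-q α, p α]` is the family of
levels of a fuzzy number. -/
theorem exists_level_eq_Icc {p q : ℝ → ℝ}
    (hp : AntitoneOn p (Icc 0 1)) (hq : AntitoneOn q (Icc 0 1))
    (hpq : -q 1 ≤ p 1)
    (hp' : ∀ α ∈ Ioc (0:ℝ) 1, ∀ x, (∀ β ∈ Ioo 0 α, x ≤ p β) → x ≤ p α)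
    (hq' : ∀ α ∈ Ioc (0:ℝ) 1, ∀ x, (∀ β ∈ Ioo 0 α, x ≤ q β) → x ≤ q α) :
    ∃ U : FuzzyNumber, (∀ α ∈ Ioc (0:ℝ) 1, fuzzyLevel U.mem α = Icc (-q α) (p α)) ∧
      fuzzyLevel U.mem 0 ⊆ Icc (-q 0) (p 0) := by
  have anti : ∀ {α β : ℝ}, 0 ≤ α → α ≤ β → β ≤ 1 →
      Icc (-q β) (p β) ⊆ Icc (-q α) (p α) := fun h0 h1 h2 =>
    Icc_subset_Icc (neg_le_neg (hq ⟨h0, h1.trans h2⟩ ⟨h0.trans h1, h2⟩ h1))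
      (hp ⟨h0, h1.trans h2⟩ ⟨h0.trans h1, h2⟩ h1)
  let S : ℝ → Set ℝ := fun x => {α ∈ Icc (0:ℝ) 1 | α = 0 ∨ x ∈ Icc (-q α) (p α)}
  let m : ℝ → ℝ := fun x => sSup (S x)
  have hS0 : ∀ x, (0:ℝ) ∈ S x := fun x => ⟨⟨le_rfl, zero_le_one⟩, Or.inl rfl⟩
  have hSb : ∀ x, BddAbove (S x) := fun x => ⟨1, fun α hα => hα.1.2⟩
  have hm : ∀ x, m x ∈ Icc (0:ℝ) 1 := fun x =>
    ⟨le_csSup (hSb x) (hS0 x), csSup_le ⟨0, hS0 x⟩ fun α hα => hα.1.2⟩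
  have key : ∀ α ∈ Ioc (0:ℝ) 1, ∀ x, α ≤ m x ↔ x ∈ Icc (-q α) (p α) := by
    intro α hα x
    refine ⟨fun h => ?_, fun h => le_csSup (hSb x) ⟨Ioc_subset_Icc_self hα, Or.inr h⟩⟩
    have hβ : ∀ β ∈ Ioo 0 α, x ∈ Icc (-q β) (p β) := by
      intro β hβ
      obtain ⟨γ, hγ, hβγ⟩ := exists_lt_of_lt_csSup ⟨0, hS0 x⟩ (hβ.2.trans_le h)
      exact anti hβ.1.le hβγ.le hγ.1.2 (hγ.2.resolve_left (hβ.1.trans hβγ).ne')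
    exact ⟨neg_le.1 (hq' α hα (-x) fun β h => neg_le.1 (hβ β h).1),
      hp' α hα x fun β h => (hβ β h).2⟩
  have hlev : ∀ α ∈ Ioc (0:ℝ) 1, fuzzyLevel m α = Icc (-q α) (p α) := fun α hα => by
    ext x
    rw [mem_level_iff hα.1, key α hα]
  have hlev0 : fuzzyLevel m 0 ⊆ Icc (-q 0) (p 0) := by
    rw [fuzzyLevel, if_pos rfl]
    exact closure_minimal (fun x hx => anti le_rfl (hm x).1 (hm x).2
      ((key _ ⟨hx, (hm x).2⟩ x).1 le_rfl)) isClosed_Icc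
  have hconv0 : Convex ℝ (fuzzyLevel m 0) := by
    rw [fuzzyLevel, if_pos rfl]
    refine Convex.closure (OrdConnected.convex ⟨fun a ha b hb c hc => ?_⟩)
    have hγ : min (m a) (m b) ∈ Ioc (0:ℝ) 1 :=
      ⟨lt_min ha hb, (min_le_left _ _).trans (hm a).2⟩
    exact hγ.1.trans_le ((key _ hγ c).2
      ⟨((key _ hγ a).1 (min_le_left _ _)).1.trans hc.1,
        hc.2.trans ((key _ hγ b).1 (min_le_right _ _)).2⟩)
  have hne : ∀ α ∈ Icc (0:ℝ) 1, (fuzzyLevel m α).Nonempty := fun α hα =>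
    ⟨p 1, level_anti hα.1 hα.2 (by
      rw [hlev 1 ⟨one_pos, le_rfl⟩]
      exact ⟨hpq, le_rfl⟩)⟩
  refine ⟨⟨m, hm, hne, fun α hα => ?_, fun α hα => ?_⟩, hlev, hlev0⟩
  · rcases hα.1.eq_or_lt with rfl | h
    · refine isCompact_Icc.of_isClosed_subset ?_ hlev0
      rw [fuzzyLevel, if_pos rfl]
      exact isClosed_closure
    · rw [hlev α ⟨h, hα.2⟩]
      exact isCompact_Icc
  · rcases hα.1.eq_or_lt with rfl | h
    · exact hconv0
    · rw [hlev α ⟨h, hα.2⟩]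
      exact convex_Icc _ _

end FuzzyNumber

theorem isSupportMedian_iff_half_le_DFT {Ω : Type*} [MeasurableSpace Ω] (P : Measure Ω)
    (𝒳 : Ω → FuzzyNumber) (A : FuzzyNumber) :
    IsSupportMedian P 𝒳 A ↔ 1/2 ≤ DFT P 𝒳 A := by
  simp only [IsSupportMedian, DFT, MedSet, le_iInf_iff, le_min_iff, mem_ofPred_eq]

section Median

variable {Ω : Type*} [MeasurableSpace Ω] (P : Measure Ω) [IsProbabilityMeasure P]

theorem half_le_measure_compl {s : Set Ω} (hs : MeasurableSet s) (h : P s ≤ 1/2) :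
    1/2 ≤ P sᶜ := by
  rw [one_div] at h ⊢
  rw [prob_compl_eq_one_sub hs, ← ENNReal.one_sub_inv_two]
  exact tsub_le_tsub_left h 1

theorem measure_compl_le_half {s : Set Ω} (hs : MeasurableSet s) (h : 1/2 ≤ P s) :
    P sᶜ ≤ 1/2 := by
  rw [one_div] at h ⊢
  rw [prob_compl_eq_one_sub hs, ← ENNReal.one_sub_inv_two]
  exact tsub_le_tsub_left h 1

/-- A bound on the measures of an antitone sequence of measurable sets passes to any set
containing the intersection. -/
theorem half_le_measure_of_antitone {s : ℕ → Set Ω} {t : Set Ω} (hs : ∀ n, MeasurableSet (s n))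
    (hanti : Antitone s) (hst : ⋂ n, s n ⊆ t) (h : ∀ n, 1/2 ≤ P (s n)) : 1/2 ≤ P t :=
  (ge_of_tendsto' (tendsto_measure_iInter_atTop (fun n => (hs n).nullMeasurableSet) hanti
    ⟨0, measure_ne_top P _⟩) h).trans (measure_mono hst)

theorem exists_upper_median {Y : Ω → ℝ} (hY : Measurable Y) :
    ∃ h ∈ MedSet P Y, ∀ x, 1/2 ≤ P {ω | x ≤ Y ω} → x ≤ h := by
  let S : Set ℝ := {x | 1/2 ≤ P {ω | x ≤ Y ω}}
  have hge : ∀ x, MeasurableSet {ω | x ≤ Y ω} := fun x => measurableSet_le measurable_const hY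
  have hle : ∀ x, MeasurableSet {ω | Y ω ≤ x} := fun x => measurableSet_le hY measurable_const
  have : IsProbabilityMeasure (P.map Y) := Measure.isProbabilityMeasure_map hY.aemeasurable
  have half_lt : (1/2 : ℝ≥0∞) < (P.map Y) univ := by
    rw [measure_univ, one_div]
    exact ENNReal.one_half_lt_one
  have hne : S.Nonempty := by
    obtain ⟨x, hx⟩ := ((tendsto_measure_Ici_atBot (P.map Y)).eventually_const_lt half_lt).exists
    rw [Measure.map_apply hY measurableSet_Ici] at hx
    exact ⟨x, hx.le⟩
  have hbdd : BddAbove S := by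
    obtain ⟨x, hx⟩ := ((tendsto_measure_Iic_atTop (P.map Y)).eventually_const_lt half_lt).exists
    rw [Measure.map_apply hY measurableSet_Iic] at hx
    refine ⟨x, fun y hy => le_of_not_gt fun hxy => hx.not_ge ?_⟩
    refine (measure_mono fun ω hω => ?_).trans (measure_compl_le_half P (hge y) hy)
    exact not_le.2 (lt_of_le_of_lt hω hxy)
  have hε : ∀ n : ℕ, (0:ℝ) < 1 / ((n : ℝ) + 1) := fun n => Nat.one_div_pos_of_nat
  have hlim : Tendsto (fun n : ℕ => 1 / ((n : ℝ) + 1)) atTop (𝓝 0) :=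
    tendsto_one_div_add_atTop_nhds_zero_nat
  refine ⟨sSup S, ⟨?_, ?_⟩, fun x hx => le_csSup hbdd hx⟩
  · refine half_le_measure_of_antitone P (s := fun n : ℕ => {ω | Y ω ≤ sSup S + 1 / ((n : ℝ) + 1)})
      (fun n => hle _) (fun m n hmn ω hω => ?_) (fun ω hω => ?_) fun n => ?_
    · have hω : Y ω ≤ sSup S + 1 / ((n : ℝ) + 1) := hω
      exact hω.trans (by gcongr)
    · have := hlim.const_add (sSup S)
      rw [add_zero] at this
      exact ge_of_tendsto' this fun n => mem_iInter.1 hω n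
    · have hnot : ¬ 1/2 ≤ P {ω | sSup S + 1 / ((n : ℝ) + 1) ≤ Y ω} := fun h => by
        linarith [le_csSup hbdd (show _ ∈ S from h), hε n]
      refine (half_le_measure_compl P (hge _) (not_le.1 hnot).le).trans (measure_mono ?_)
      exact fun ω hω => show Y ω ≤ _ from (lt_of_not_ge fun h => hω h).le
  · refine half_le_measure_of_antitone P (s := fun n : ℕ => {ω | sSup S - 1 / ((n : ℝ) + 1) ≤ Y ω})
      (fun n => hge _) (fun m n hmn ω hω => ?_) (fun ω hω => ?_) fun n => ?_
    · have hω : sSup S - 1 / ((n : ℝ) + 1) ≤ Y ω := hω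
      exact le_trans (by gcongr) hω
    · have := hlim.const_sub (sSup S)
      rw [sub_zero] at this
      exact le_of_tendsto' this fun n => mem_iInter.1 hω n
    · obtain ⟨y, hy, hlt⟩ := exists_lt_of_lt_csSup hne (sub_lt_self (sSup S) (hε n))
      exact le_trans hy (measure_mono fun ω hω => hlt.le.trans hω)

/-- Every median maximizes the univariate Tukey depth. -/
theorem tukey_depth_le_of_mem_medSet {Y : Ω → ℝ} (hY : Measurable Y) {m : ℝ}
    (hm : m ∈ MedSet P Y) (x : ℝ) :
    min (P {ω | Y ω ≤ x}) (P {ω | x ≤ Y ω}) ≤ min (P {ω | Y ω ≤ m}) (P {ω | m ≤ Y ω}) := by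
  rcases lt_trichotomy x m with h | rfl | h
  · refine (min_le_left _ _).trans (le_min (measure_mono fun ω hω => hω.trans h.le) ?_)
    have := measure_compl_le_half P (measurableSet_le measurable_const hY) hm.2
    exact ((measure_mono fun ω hω => not_le.2 (hω.trans_lt h)).trans this).trans hm.2
  · exact le_rfl
  · refine (min_le_right _ _).trans (le_min ?_ (measure_mono fun ω hω => h.le.trans hω))
    have := measure_compl_le_half P (measurableSet_le hY measurable_const) hm.1
    exact ((measure_mono fun ω hω => not_le.2 (h.trans_le hω)).trans this).trans hm.1

theorem exists_isSupportMedian {𝒳 : Ω → FuzzyNumber} (hmeas : SuppMeasurable 𝒳) :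
    ∃ U, IsSupportMedian P 𝒳 U := by
  have hex : ∀ u α : ℝ, ∃ h : ℝ, u ∈ ({-1, 1} : Set ℝ) → α ∈ Icc (0:ℝ) 1 →
      h ∈ MedSet P (fun ω => suppFn (𝒳 ω) u α) ∧
      ∀ x, 1/2 ≤ P {ω | x ≤ suppFn (𝒳 ω) u α} → x ≤ h := by
    intro u α
    by_cases hu : u ∈ ({-1, 1} : Set ℝ) ∧ α ∈ Icc (0:ℝ) 1
    · obtain ⟨h, h₁, h₂⟩ := exists_upper_median P (hmeas u hu.1 α hu.2)
      exact ⟨h, fun _ _ => ⟨h₁, h₂⟩⟩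
    · exact ⟨0, fun h₁ h₂ => absurd ⟨h₁, h₂⟩ hu⟩
  choose h hh using hex
  have hanti : ∀ u ∈ ({-1, 1} : Set ℝ), AntitoneOn (h u) (Icc 0 1) :=
    fun u hu α hα β hβ hαβ => (hh u α hu hα).2 _ ((hh u β hu hβ).1.2.trans
      (measure_mono fun ω hω => le_trans hω ((𝒳 ω).suppFn_antitoneOn u hα hβ hαβ)))
  have hleft : ∀ u ∈ ({-1, 1} : Set ℝ), ∀ α ∈ Ioc (0:ℝ) 1, ∀ x,
      (∀ β ∈ Ioo 0 α, x ≤ h u β) → x ≤ h u α := by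
    intro u hu α hα x hx
    obtain ⟨b, hb, hbα, hlim⟩ := exists_seq_strictMono_tendsto' hα.1
    have hb₀ : ∀ n, b n ∈ Ioc (0:ℝ) 1 := fun n => ⟨(hbα n).1, (hbα n).2.le.trans hα.2⟩
    have hb₁ : ∀ n, b n ∈ Icc (0:ℝ) 1 := fun n => Ioc_subset_Icc_self (hb₀ n)
    refine (hh u α hu (Ioc_subset_Icc_self hα)).2 x ?_
    refine half_le_measure_of_antitone P (s := fun n => {ω | x ≤ suppFn (𝒳 ω) u (b n)})
      (fun n => measurableSet_le measurable_const (hmeas u hu _ (hb₁ n)))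
      (fun m n hmn ω hω => ?_) (fun ω hω => ?_) fun n => ?_
    · exact le_trans hω ((𝒳 ω).suppFn_antitoneOn u (hb₁ m) (hb₁ n) (hb.monotone hmn))
    · exact (𝒳 ω).le_suppFn_of_tendsto u (Ioc_subset_Icc_self hα) hb.monotone hb₀ hlim
        (mem_iInter.1 hω)
    · exact (hh u _ hu (hb₁ n)).1.2.trans (measure_mono fun ω hω => (hx _ (hbα n)).trans hω)
  have hone : (1:ℝ) ∈ ({-1, 1} : Set ℝ) := by simp
  have hneg : (-1:ℝ) ∈ ({-1, 1} : Set ℝ) := by simp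
  have hI0 : (0:ℝ) ∈ Icc (0:ℝ) 1 := ⟨le_rfl, zero_le_one⟩
  have hI1 : (1:ℝ) ∈ Icc (0:ℝ) 1 := ⟨zero_le_one, le_rfl⟩
  have hpq : ∀ α ∈ Icc (0:ℝ) 1, -h (-1) α ≤ h 1 α := fun α hα =>
    (hh 1 α hone hα).2 _ ((hh (-1) α hneg hα).1.1.trans (measure_mono fun ω hω =>
      (neg_le_neg hω).trans ((𝒳 ω).neg_suppFn_neg_one_le hα)))
  obtain ⟨U, hU, hU0⟩ := FuzzyNumber.exists_level_eq_Icc (hanti 1 hone) (hanti (-1) hneg)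
    (hpq 1 hI1) (hleft 1 hone) (hleft (-1) hneg)
  have hs : ∀ u ∈ ({-1, 1} : Set ℝ), ∀ α ∈ Ioc (0:ℝ) 1, suppFn U u α = h u α := by
    intro u hu α hα
    have hα' := Ioc_subset_Icc_self hα
    have hle := hpq α hα'
    rcases hu with rfl | rfl
    · refine le_antisymm (U.suppFn_le hα' fun v hv => ?_) ?_
      · rw [hU α hα] at hv
        linarith [hv.1]
      · have := U.mul_le_suppFn (-1) hα' ((hU α hα).symm ▸ left_mem_Icc.2 hle)
        linarith
    · refine le_antisymm (U.suppFn_le hα' fun v hv => ?_) ?_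
      · rw [hU α hα] at hv
        linarith [hv.2]
      · have := U.mul_le_suppFn 1 hα' ((hU α hα).symm ▸ right_mem_Icc.2 hle)
        linarith
  have hs0 : ∀ u ∈ ({-1, 1} : Set ℝ), suppFn U u 0 ≤ h u 0 := by
    rintro u (rfl | rfl)
    · exact U.suppFn_le hI0 fun v hv => by linarith [(hU0 hv).1]
    · exact U.suppFn_le hI0 fun v hv => by linarith [(hU0 hv).2]
  refine ⟨U, fun u hu α hα => ?_⟩
  rcases hα.1.eq_or_lt with rfl | hpos
  · have hb₀ : ∀ n : ℕ, 1 / ((n : ℝ) + 1) ∈ Ioc (0:ℝ) 1 := fun n =>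
      ⟨Nat.one_div_pos_of_nat, by simpa using Nat.one_div_le_one_div (α := ℝ) n.zero_le⟩
    have hb₁ : ∀ n : ℕ, 1 / ((n : ℝ) + 1) ∈ Icc (0:ℝ) 1 := fun n => Ioc_subset_Icc_self (hb₀ n)
    refine ⟨?_, (hh u 0 hu hα).1.2.trans (measure_mono fun ω hω => (hs0 u hu).trans hω)⟩
    refine half_le_measure_of_antitone P
      (s := fun n : ℕ => {ω | suppFn (𝒳 ω) u (1 / ((n : ℝ) + 1)) ≤ suppFn U u 0})
      (fun n => measurableSet_le (hmeas u hu _ (hb₁ n)) measurable_const)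
      (fun m n hmn ω hω => ?_) (fun ω hω => ?_) fun n => ?_
    · exact le_trans
        ((𝒳 ω).suppFn_antitoneOn u (hb₁ n) (hb₁ m) (Nat.one_div_le_one_div hmn)) hω
    · exact (𝒳 ω).suppFn_zero_le u fun n => mem_iInter.1 hω n
    · refine (hh u _ hu (hb₁ n)).1.1.trans (measure_mono fun ω hω => ?_)
      rw [← hs u hu _ (hb₀ n)] at hω
      exact le_trans hω (U.suppFn_antitoneOn u hI0 (hb₁ n) (hb₀ n).1.le)
  · rw [hs u hu α ⟨hpos, hα.2⟩]
    exact (hh u α hu hα).1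

end Median

end Auxiliary

/-- For an arbitrary fuzzy random number (no integrability needed), the support medians
are exactly the maximizers of the fuzzy Tukey depth `D_FT(·;𝒳)` over `F_c(ℝ)`. -/
theorem support_median_iff_tukey_median
    {Ω : Type*} [MeasurableSpace Ω] (P : Measure Ω) [IsProbabilityMeasure P]
    (𝒳 : Ω → FuzzyNumber) (hmeas : SuppMeasurable 𝒳) (hjoint : JointlyMeasurable 𝒳)
    (A : FuzzyNumber) :
    IsSupportMedian P 𝒳 A ↔ (∀ U : FuzzyNumber, DFT P 𝒳 U ≤ DFT P 𝒳 A) := by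
  rw [isSupportMedian_iff_half_le_DFT]
  refine ⟨fun hA U => ?_, fun hA => ?_⟩
  · have hmed := (isSupportMedian_iff_half_le_DFT P 𝒳 A).2 hA
    exact iInf₂_mono fun u hu => iInf₂_mono fun α hα =>
      tukey_depth_le_of_mem_medSet P (hmeas u hu α hα) (hmed u hu α hα) _
  · obtain ⟨U, hU⟩ := exists_isSupportMedian P hmeas
    exact ((isSupportMedian_iff_half_le_DFT P 𝒳 U).1 hU).trans (hA U)

end
end

section
/- Let A and B be fuzzy numbers and set C_{A,B} := {(u,α) ∈ {−1,1} × [0,1] : s_A(u,α) ≠ s_B(u,α)}. If A ≠ B, then (υ⊗ν)(C_{A,B}) > 0, where υ is the uniform probability measure on {−1,1} and ν is Lebesgue measure on [0,1]. Equivalently, two fuzzy numbers whose support functions agree (υ⊗ν)-almost everywhere on {−1,1} × [0,1] are equal. -/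
open MeasureTheory Set ENNReal

noncomputable section

theorem FuzzyNumber.ext_mem {A B : FuzzyNumber} (h : A.mem = B.mem) : A = B := by
  cases A
  cases B
  cases h
  rfl

/-- Each α-level is recovered from the values of the support function at `1` and `-1`. -/
theorem mem_fuzzyLevel_iff_le_suppFn (A : FuzzyNumber) {α : ℝ} (hα : α ∈ Icc (0:ℝ) 1) (x : ℝ) :
    x ∈ fuzzyLevel A.mem α ↔ 1 * x ≤ suppFn A 1 α ∧ -1 * x ≤ suppFn A (-1) α := by
  have hcompact : ∀ u : ℝ, IsCompact ((fun v => u * v) '' fuzzyLevel A.mem α) := fun u =>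
    (A.level_compact α hα).image (by fun_prop)
  have hattained : ∀ u : ℝ, ∃ v ∈ fuzzyLevel A.mem α, u * v = suppFn A u α := fun u =>
    (hcompact u).sSup_mem ((A.level_nonempty α hα).image _)
  constructor
  · intro hx
    exact ⟨le_csSup (hcompact 1).bddAbove (mem_image_of_mem _ hx),
      le_csSup (hcompact (-1)).bddAbove (mem_image_of_mem _ hx)⟩
  · rintro ⟨h₁, h₂⟩
    obtain ⟨v, hv, hv'⟩ := hattained 1
    obtain ⟨w, hw, hw'⟩ := hattained (-1)
    exact (A.level_convex α hα).ordConnected.out hw hv ⟨by linarith, by linarith⟩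

instance : IsFiniteMeasure coinMeasure := by
  unfold coinMeasure
  exact Measure.smul_finite _ (by simp)

theorem coinMeasure_singleton_ne_zero {u : ℝ} (hu : u ∈ ({-1, 1} : Set ℝ)) :
    coinMeasure {u} ≠ 0 := by
  rcases hu with rfl | rfl <;> simp [coinMeasure]

/-- Every section over a point of `{-1, 1}` of a `baseMeasure`-null set is null. -/
theorem volume_section_eq_zero {C : Set (ℝ × ℝ)} (hC : baseMeasure C = 0)
    {u : ℝ} (hu : u ∈ ({-1, 1} : Set ℝ)) :
    volume.restrict (Icc (0:ℝ) 1) {α | (u, α) ∈ C} = 0 := by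
  have hsub : ({u} : Set ℝ) ×ˢ {α | (u, α) ∈ C} ⊆ C := by
    rintro ⟨v, α⟩ ⟨rfl, hα⟩
    exact hα
  have h := measure_mono_null hsub hC
  rw [baseMeasure, Measure.prod_prod] at h
  exact (mul_eq_zero.mp h).resolve_left (coinMeasure_singleton_ne_zero hu)

theorem mem_le_mem_of_ae_suppFn_eq {A B : FuzzyNumber}
    (h : ∀ u ∈ ({-1, 1} : Set ℝ),
      ∀ᵐ α ∂(volume.restrict (Icc (0:ℝ) 1)), suppFn A u α = suppFn B u α) (x : ℝ) :
    A.mem x ≤ B.mem x := by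
  refine le_of_forall_lt_imp_le_of_dense fun β hβ => ?_
  rcases lt_or_ge β 0 with hβ0 | hβ0
  · exact hβ0.le.trans (B.mem_range x).1
  have hsub : Ioo β (A.mem x) ⊆ Icc 0 1 := fun γ hγ =>
    ⟨hβ0.trans hγ.1.le, hγ.2.le.trans (A.mem_range x).2⟩
  obtain ⟨γ, hγ, h₁, h₂⟩ : ∃ γ ∈ Ioo β (A.mem x),
      suppFn A 1 γ = suppFn B 1 γ ∧ suppFn A (-1) γ = suppFn B (-1) γ := by
    have hae := ae_restrict_of_ae_restrict_of_subset hsub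
      ((h 1 (by simp)).and (h (-1) (by simp)))
    by_contra! hne
    have hnull : ∀ᵐ γ ∂(volume.restrict (Ioo β (A.mem x))), False := by
      filter_upwards [hae, ae_restrict_mem measurableSet_Ioo] with γ hγ hmem
      exact hne γ hmem hγ.1 hγ.2
    rw [ae_iff] at hnull
    simp at hnull
    linarith
  have hγ0 : γ ≠ 0 := (hβ0.trans_lt hγ.1).ne'
  have hxA : x ∈ fuzzyLevel A.mem γ := by
    simpa [fuzzyLevel, hγ0] using hγ.2.le
  have hxB : x ∈ fuzzyLevel B.mem γ := by
    rw [mem_fuzzyLevel_iff_le_suppFn B (hsub hγ), ← h₁, ← h₂]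
    exact (mem_fuzzyLevel_iff_le_suppFn A (hsub hγ) x).mp hxA
  have hγB : γ ≤ B.mem x := by simpa [fuzzyLevel, hγ0] using hxB
  exact hγ.1.le.trans hγB

/-- If two fuzzy numbers are distinct, then the set where their support functions differ
has positive `υ⊗ν`-measure on `{−1,1} × [0,1]`; equivalently, fuzzy numbers whose support
functions agree almost everywhere are equal. -/
theorem support_functions_differ_on_positive_measure_set
    (A B : FuzzyNumber) (hAB : A ≠ B) :
    0 < baseMeasure {p : ℝ × ℝ | p.1 ∈ ({-1, 1} : Set ℝ) ∧ p.2 ∈ Set.Icc (0:ℝ) 1 ∧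
      suppFn A p.1 p.2 ≠ suppFn B p.1 p.2} := by
  rw [pos_iff_ne_zero]
  intro hnull
  have hae : ∀ u ∈ ({-1, 1} : Set ℝ),
      ∀ᵐ α ∂(volume.restrict (Icc (0:ℝ) 1)), suppFn A u α = suppFn B u α := by
    intro u hu
    have hsection := measure_eq_zero_iff_ae_notMem.mp (volume_section_eq_zero hnull hu)
    filter_upwards [hsection, ae_restrict_mem measurableSet_Icc] with α hα hmem
    by_contra hne
    exact hα ⟨hu, hmem, hne⟩
  refine hAB (FuzzyNumber.ext_mem (funext fun x => le_antisymm ?_ ?_))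
  · exact mem_le_mem_of_ae_suppFn_eq hae x
  · exact mem_le_mem_of_ae_suppFn_eq
      (fun u hu => (hae u hu).mono fun _ hα => hα.symm) x

end
end

section
/- Let X be a real random variable with cumulative distribution function F given by F(x) = 0 for x < 0, F(x) = 0.145x for 0 ≤ x < 2, F(x) = 0.01x + 0.47 for 2 ≤ x < 53, and F(x) = 1 for x ≥ 53. Then: (i) the unique median of X is 3; (ii) for the function g(t) := 1 − (1 − F(t))² − (F(t) − P(X = t))², which equals P(min(X₁,X₂) ≤ t ≤ max(X₁,X₂)) for X₁, X₂ independent copies of X, one has g(3) = 0.5 and g(2) = 0.6558, so g(2) > g(3) and the unique median of X does not maximize g. (This shows the support median need not maximize the fuzzy simplicial depths when the distribution is not atomless.) -/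
open MeasureTheory

open ProbabilityTheory Filter Topology in
/-- The mass of a point is the jump of the distribution function there. -/
theorem toReal_measure_eq_sub_of_tendsto_cdf
    {Ω : Type*} [MeasurableSpace Ω] {P : Measure Ω} [IsProbabilityMeasure P]
    {X : Ω → ℝ} (hX : Measurable X) {F : ℝ → ℝ}
    (hcdf : ∀ x, (P {ω | X ω ≤ x}).toReal = F x) {t L : ℝ}
    (hL : Tendsto F (𝓝[<] t) (𝓝 L)) :
    (P {ω | X ω = t}).toReal = F t - L := by
  have : IsProbabilityMeasure (P.map X) := Measure.isProbabilityMeasure_map hX.aemeasurable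
  have hF : ⇑(cdf (P.map X)) = F := by
    ext x
    rw [cdf_eq_real, measureReal_def, Measure.map_apply hX measurableSet_Iic, ← hcdf]
    rfl
  have hmono : Monotone F := hF ▸ monotone_cdf _
  have hmap : P {ω | X ω = t} = P.map X {t} :=
    (Measure.map_apply hX (measurableSet_singleton t)).symm
  rw [hmap, ← measure_cdf (P.map X), StieltjesFunction.measure_singleton, hF,
    leftLim_eq_of_tendsto hL, ENNReal.toReal_ofReal]
  exact sub_nonneg.2 (le_of_tendsto hL
    (eventually_nhdsWithin_of_forall fun x hx => hmono (le_of_lt hx)))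

/-- For the random variable `X` with c.d.f. `F(x) = 0` (x < 0), `0.145x` (0 ≤ x < 2),
`0.01x + 0.47` (2 ≤ x < 53) and `1` (x ≥ 53): the unique median of `X` is 3, and for
`g(t) := 1 − (1 − F(t))² − (F(t) − P(X = t))²` one has `g(3) = 0.5`, `g(2) = 0.6558`,
so the unique median does not maximize `g`. -/
theorem median_need_not_maximize_simplicial
    {Ω : Type*} [MeasurableSpace Ω] (P : Measure Ω) [IsProbabilityMeasure P]
    (X : Ω → ℝ) (hX : Measurable X) (F : ℝ → ℝ)
    (hF : ∀ x, F x = if x < 0 then 0 else if x < 2 then 0.145 * x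
            else if x < 53 then 0.01 * x + 0.47 else 1)
    (hcdf : ∀ x, (P {ω | X ω ≤ x}).toReal = F x) :
    MedSet P X = {3} ∧
    1 - (1 - F 3) ^ 2 - (F 3 - (P {ω | X ω = 3}).toReal) ^ 2 = 0.5 ∧
    1 - (1 - F 2) ^ 2 - (F 2 - (P {ω | X ω = 2}).toReal) ^ 2 = 0.6558 ∧
    1 - (1 - F 3) ^ 2 - (F 3 - (P {ω | X ω = 3}).toReal) ^ 2 <
      1 - (1 - F 2) ^ 2 - (F 2 - (P {ω | X ω = 2}).toReal) ^ 2 := by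
  have hlt (x : ℝ) : (P {ω | x < X ω}).toReal = 1 - F x := by
    have h := probReal_compl_eq_one_sub (μ := P) (measurableSet_le hX (measurable_const (a := x)))
    rw [measureReal_def, measureReal_def, hcdf] at h
    rw [← h]
    congr 2
    ext ω
    simp
  have hhalf (s : Set Ω) : 1 / 2 ≤ P s ↔ 1 / 2 ≤ (P s).toReal := by
    rw [← ENNReal.toReal_le_toReal (by simp) (measure_ne_top P s)]
    simp
  have hF3 : F 3 = 0.5 := by rw [hF]; norm_num
  have hF2 : F 2 = 0.49 := by rw [hF]; norm_num
  have hP3 : (P {ω | X ω = 3}).toReal = 0 := by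
    have hlim : Filter.Tendsto F (nhdsWithin 3 (Set.Iio 3)) (nhds (0.01 * 3 + 0.47)) := by
      refine Filter.Tendsto.congr' (f₁ := fun x : ℝ => 0.01 * x + 0.47) ?_
        ((Continuous.tendsto (by fun_prop) 3).mono_left nhdsWithin_le_nhds)
      filter_upwards [Ioo_mem_nhdsLT (show (2 : ℝ) < 3 by norm_num)] with x hx
      rw [hF, if_neg (by linarith [hx.1]), if_neg (by linarith [hx.1]),
        if_pos (by linarith [hx.2])]
    rw [toReal_measure_eq_sub_of_tendsto_cdf hX hcdf hlim, hF3]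
    norm_num
  have hP2 : (P {ω | X ω = 2}).toReal = 0.2 := by
    have hlim : Filter.Tendsto F (nhdsWithin 2 (Set.Iio 2)) (nhds (0.145 * 2)) := by
      refine Filter.Tendsto.congr' (f₁ := fun x : ℝ => 0.145 * x) ?_
        ((Continuous.tendsto (by fun_prop) 2).mono_left nhdsWithin_le_nhds)
      filter_upwards [Ioo_mem_nhdsLT (show (0 : ℝ) < 2 by norm_num)] with x hx
      rw [hF, if_neg (by linarith [hx.1]), if_pos hx.2]
    rw [toReal_measure_eq_sub_of_tendsto_cdf hX hcdf hlim, hF2]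
    norm_num
  refine ⟨?_, ?_, ?_, ?_⟩
  · ext m
    simp only [MedSet, Set.mem_ofPred_eq, Set.mem_singleton_iff, hhalf, hcdf]
    constructor
    · rintro ⟨hle, hge⟩
      refine le_antisymm ?_ ?_
      · by_contra! hm
        obtain ⟨s, hs, hsm⟩ := exists_between hm
        have hsub : (P {ω | m ≤ X ω}).toReal ≤ (P {ω | s < X ω}).toReal :=
          measureReal_mono fun ω (hω : m ≤ X ω) => hsm.trans_le hω
        rw [hlt, hF, if_neg (by linarith), if_neg (by linarith)] at hsub
        split_ifs at hsub <;> linarith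
      · by_contra! hm
        rw [hF] at hle
        split_ifs at hle <;> linarith
    · rintro rfl
      refine ⟨by rw [hF3]; norm_num, ?_⟩
      have hsub : (P {ω | 3 < X ω}).toReal ≤ (P {ω | 3 ≤ X ω}).toReal :=
        measureReal_mono fun ω (hω : 3 < X ω) => hω.le
      rw [hlt, hF3] at hsub
      linarith
  all_goals
    simp only [hF3, hF2, hP3, hP2]
    norm_num
end

section
/- Let (Ω, 𝒫(Ω), P) be the probability space with Ω = {ω₁,ω₂} and P uniform, and let 𝒳 : Ω → F_c(ℝ) be the fuzzy random number with 𝒳(ω₁) = I_{1} and 𝒳(ω₂) = I_{3}. Then both A := I_{2} and B := T(1,2,3) are support medians of 𝒳 (equivalently, 1-medians), yet their fuzzy projection depths differ: O(A;𝒳) = 0 and O(B;𝒳) = 1, so D_FP(A;𝒳) = 1 while D_FP(B;𝒳) = 1/2 < D_FP(A;𝒳). Hence when the medians of s_𝒳(u,α) are not unique, Med(𝒳;D_FP) can be a strict subset of Med_s(𝒳). -/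
open MeasureTheory Set ENNReal

noncomputable section

/-- The uniform probability measure on `Fin 2`. -/
def Punif2 : Measure (Fin 2) :=
  (2 : ℝ≥0∞)⁻¹ • (Measure.dirac 0 + Measure.dirac 1)

theorem half_le_Punif2_iff (p : Fin 2 → Prop) :
    1 / 2 ≤ Punif2 {ω | p ω} ↔ p 0 ∨ p 1 := by
  classical
  have hsum : (2 : ℝ≥0∞)⁻¹ * (1 + 1) = 1 := by
    rw [one_add_one_eq_two, ENNReal.inv_mul_cancel two_ne_zero ofNat_ne_top]
  have hhalf : (2 : ℝ≥0∞)⁻¹ ≤ 1 := ENNReal.inv_le_one.2 one_le_two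
  by_cases h0 : p 0 <;> by_cases h1 : p 1 <;>
    simp [Punif2, Set.indicator, h0, h1, hsum, hhalf, -smul_add]

/-- The medians of a random variable taking two equally likely values. -/
theorem medSet_Punif2 (Y : Fin 2 → ℝ) :
    MedSet Punif2 Y = Set.Icc (min (Y 0) (Y 1)) (max (Y 0) (Y 1)) := by
  ext m
  simp [MedSet, -one_div, half_le_Punif2_iff]

theorem medMid_Punif2 (Y : Fin 2 → ℝ) : medMid Punif2 Y = (Y 0 + Y 1) / 2 := by
  have h : min (Y 0) (Y 1) ≤ max (Y 0) (Y 1) := min_le_max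
  rw [medMid, medSet_Punif2, csInf_Icc h, csSup_Icc h, min_add_max]

theorem MAD_Punif2 (Y : Fin 2 → ℝ) : MAD Punif2 Y = |Y 0 - Y 1| / 2 := by
  rw [MAD, medMid_Punif2, medMid_Punif2]
  have h0 : Y 0 - (Y 0 + Y 1) / 2 = (Y 0 - Y 1) / 2 := by ring
  have h1 : Y 1 - (Y 0 + Y 1) / 2 = -((Y 0 - Y 1) / 2) := by ring
  rw [h0, h1, abs_neg, add_self_div_two, abs_div, abs_two]

theorem suppFn_of_level_singleton {A : FuzzyNumber} {α c : ℝ}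
    (h : fuzzyLevel A.mem α = {c}) (u : ℝ) : suppFn A u α = u * c := by
  simp [suppFn, h]

theorem suppFn_one_of_level_Icc {A : FuzzyNumber} {α a b : ℝ} (hab : a ≤ b)
    (h : fuzzyLevel A.mem α = Set.Icc a b) : suppFn A 1 α = b := by
  simp [suppFn, h, csSup_Icc hab]

theorem suppFn_neg_one_of_level_Icc {A : FuzzyNumber} {α a b : ℝ} (hab : a ≤ b)
    (h : fuzzyLevel A.mem α = Set.Icc a b) : suppFn A (-1) α = -a := by
  simp [suppFn, h, csSup_Icc (neg_le_neg hab)]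

/-- For the fuzzy random number with values `I_{1}` and `I_{3}`, each with probability 1/2:
both `A = I_{2}` and `B = T(1,2,3)` are support medians, yet `O(A;𝒳) = 0`, `O(B;𝒳) = 1`,
so `D_FP(A;𝒳) = 1` while `D_FP(B;𝒳) = 1/2 < D_FP(A;𝒳)`. -/
theorem projection_depth_distinguishes_support_medians
    (𝒳 : Fin 2 → FuzzyNumber)
    (hX1 : ∀ α ∈ Set.Icc (0:ℝ) 1, fuzzyLevel (𝒳 0).mem α = {1})
    (hX2 : ∀ α ∈ Set.Icc (0:ℝ) 1, fuzzyLevel (𝒳 1).mem α = {3})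
    (A B : FuzzyNumber)
    (hA : ∀ α ∈ Set.Icc (0:ℝ) 1, fuzzyLevel A.mem α = {2})
    (hB : ∀ α ∈ Set.Icc (0:ℝ) 1, fuzzyLevel B.mem α = Set.Icc (1 + α) (3 - α)) :
    IsSupportMedian Punif2 𝒳 A ∧ IsSupportMedian Punif2 𝒳 B ∧
    outly Punif2 𝒳 A = 0 ∧ outly Punif2 𝒳 B = 1 ∧
    DFP Punif2 𝒳 A = 1 ∧ DFP Punif2 𝒳 B = 1/2 ∧
    DFP Punif2 𝒳 B < DFP Punif2 𝒳 A := by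
  have hA' : ∀ u, ∀ α ∈ Set.Icc (0:ℝ) 1, suppFn A u α = u * 2 := fun u α hα =>
    suppFn_of_level_singleton (hA α hα) u
  have hB1 : ∀ α ∈ Set.Icc (0:ℝ) 1, suppFn B 1 α = 3 - α := fun α hα =>
    suppFn_one_of_level_Icc (by linarith [hα.2]) (hB α hα)
  have hB2 : ∀ α ∈ Set.Icc (0:ℝ) 1, suppFn B (-1) α = -(1 + α) := fun α hα =>
    suppFn_neg_one_of_level_Icc (by linarith [hα.2]) (hB α hα)
  have h0 : ∀ u, ∀ α ∈ Set.Icc (0:ℝ) 1, suppFn (𝒳 0) u α = u * 1 := fun u α hα =>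
    suppFn_of_level_singleton (hX1 α hα) u
  have h1 : ∀ u, ∀ α ∈ Set.Icc (0:ℝ) 1, suppFn (𝒳 1) u α = u * 3 := fun u α hα =>
    suppFn_of_level_singleton (hX2 α hα) u
  have hmid : ∀ u, ∀ α ∈ Set.Icc (0:ℝ) 1,
      medMid Punif2 (fun ω => suppFn (𝒳 ω) u α) = u * 2 := by
    intro u α hα
    rw [medMid_Punif2, h0 u α hα, h1 u α hα]
    ring
  have hMAD : ∀ u ∈ ({-1, 1} : Set ℝ), ∀ α ∈ Set.Icc (0:ℝ) 1,
      MAD Punif2 (fun ω => suppFn (𝒳 ω) u α) = 1 := by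
    intro u hu α hα
    rw [MAD_Punif2, h0 u α hα, h1 u α hα]
    rcases hu with rfl | rfl <;> norm_num
  have hOA : outly Punif2 𝒳 A = 0 := by
    refine IsGreatest.csSup_eq ⟨⟨1, by simp, 0, by simp, ?_⟩, ?_⟩
    · rw [hA' _ _ (by simp), hmid _ _ (by simp), sub_self, abs_zero, zero_div]
    · rintro r ⟨u, -, α, hα, rfl⟩
      rw [hA' u α hα, hmid u α hα, sub_self, abs_zero, zero_div]
  have hOB : outly Punif2 𝒳 B = 1 := by
    refine IsGreatest.csSup_eq ⟨⟨1, by simp, 0, by simp, ?_⟩, ?_⟩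
    · rw [hB1 _ (by simp), hmid _ _ (by simp), hMAD _ (by simp) _ (by simp)]
      norm_num
    · rintro r ⟨u, hu, α, hα, rfl⟩
      rw [hmid u α hα, hMAD u hu α hα, div_one, abs_le]
      obtain ⟨hα0, hα1⟩ := hα
      rcases hu with rfl | rfl
      · rw [hB2 α ⟨hα0, hα1⟩]
        constructor <;> linarith
      · rw [hB1 α ⟨hα0, hα1⟩]
        constructor <;> linarith
  refine ⟨?_, ?_, hOA, hOB, ?_, ?_, ?_⟩
  · intro u hu α hα
    rw [medSet_Punif2, h0 u α hα, h1 u α hα, hA' u α hα]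
    rcases hu with rfl | rfl <;> norm_num
  · intro u hu α hα
    rw [medSet_Punif2, h0 u α hα, h1 u α hα]
    obtain ⟨hα0, hα1⟩ := hα
    rcases hu with rfl | rfl
    · rw [hB2 α ⟨hα0, hα1⟩]
      norm_num
      constructor <;> linarith
    · rw [hB1 α ⟨hα0, hα1⟩]
      norm_num
      constructor <;> linarith
  · norm_num [DFP, hOA]
  · norm_num [DFP, hOB]
  · norm_num [DFP, hOA, hOB]

end
end
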